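/- arXiv:1302.4086 — 14 statements merged into one kernel-verified Lean document; each statement's English description precedes it below -/
import Mathlib

section
/- Let p be a prime, let Y be a topological space with infinitely many points, and let N ∈ ℤ. Then there exists a continuous function f : ℚ_p → Y such that for every h ∈ ℚ_p one has (f(x+h) = f(x) for all x ∈ ℚ_p) if and only if h ∈ p^N ℤ_p. In particular such an f is non-constant. -/
/-- There exist continuous functions `f : ℚ_p → Y` whose set of periods is
exactly `p^N ℤ_p = {h : ‖h‖_p ≤ p^(-N)}`; such functions are non-constant. -/
theorem padic_exists_continuous_with_period_group
    (p : ℕ) [Fact p.Prime] (Y : Type*) [TopologicalSpace Y] [Infinite Y] (N : ℤ) :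
    ∃ f : ℚ_[p] → Y, Continuous f ∧
      (∀ h : ℚ_[p], (∀ x : ℚ_[p], f (x + h) = f x) ↔ ‖h‖ ≤ (p : ℝ) ^ (-N)) ∧
      ¬ ∃ c : Y, ∀ x : ℚ_[p], f x = c := by
  have hp1 : (1 : ℝ) < p := by exact_mod_cast (Fact.out : p.Prime).one_lt
  have hpos : (0 : ℝ) < (p : ℝ) ^ (-N) := zpow_pos (by linarith) _
  let S : AddSubgroup ℚ_[p] :=
    { carrier := {h | ‖h‖ ≤ (p : ℝ) ^ (-N)}
      zero_mem' := by simpa using hpos.le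
      add_mem' := fun {a b} ha hb => (Padic.nonarchimedean a b).trans (max_le ha hb)
      neg_mem' := fun {a} ha => by simpa using ha }
  have hS : ∀ h, h ∈ S ↔ ‖h‖ ≤ (p : ℝ) ^ (-N) := fun h => Iff.rfl
  have hsurj : Function.Surjective (fun q : ℚ => (QuotientAddGroup.mk (q : ℚ_[p]) : ℚ_[p] ⧸ S)) := by
    intro z
    obtain ⟨x, rfl⟩ := QuotientAddGroup.mk_surjective z
    obtain ⟨q, hq⟩ := Padic.rat_dense p x hpos
    refine ⟨q, ?_⟩
    rw [QuotientAddGroup.eq, hS, neg_add_eq_sub]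
    exact hq.le
  have : Countable (ℚ_[p] ⧸ S) := hsurj.countable
  obtain ⟨g, hg⟩ := exists_injective_nat (ℚ_[p] ⧸ S)
  let e := Infinite.natEmbedding Y
  have hf : ∀ x y : ℚ_[p], e (g (x : ℚ_[p] ⧸ S)) = e (g (y : ℚ_[p] ⧸ S)) ↔ 
      ‖y - x‖ ≤ (p : ℝ) ^ (-N) := by
    intro x y
    rw [e.injective.eq_iff, hg.eq_iff, QuotientAddGroup.eq, hS, neg_add_eq_sub]
  have hper : ∀ h : ℚ_[p], (∀ x : ℚ_[p], e (g ((x + h : ℚ_[p]) : ℚ_[p] ⧸ S)) =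
      e (g (x : ℚ_[p] ⧸ S))) ↔ ‖h‖ ≤ (p : ℝ) ^ (-N) := by
    intro h
    simp only [hf]
    simp
  refine ⟨fun x => e (g (x : ℚ_[p] ⧸ S)), ?_, hper, ?_⟩
  · apply IsLocallyConstant.continuous
    rw [IsLocallyConstant.iff_eventually_eq]
    intro x
    filter_upwards [Metric.ball_mem_nhds x hpos] with y hy
    rw [hf, ← dist_eq_norm, dist_comm]
    exact (Metric.mem_ball.1 hy).le
  · rintro ⟨c, hc⟩
    have h1 := (hper ((p : ℚ_[p]) ^ (N - 1))).1 (fun x => (hc _).trans (hc _).symm)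
    rw [Padic.norm_p_zpow, zpow_le_zpow_iff_right₀ hp1] at h1
    omega
end

section
/- Let p be a prime, let (Y,d) be a metric space, and let f : ℚ_p → Y be continuous. If h ∈ ℚ_p is a period of f with |h|_p = p^{-N} (N ∈ ℤ), then every element of p^N ℤ_p is a period of f, i.e. p^N ℤ_p ⊆ 𝔓_0(f). -/
/-- If a continuous function `f : ℚ_p → Y` (`Y` a metric space) has a period `h`
with `‖h‖_p = p^(-N)`, then every element of `p^N ℤ_p` is a period of `f`. -/
theorem padic_period_ball_subset_periods
    (p : ℕ) [Fact p.Prime] (Y : Type*) [MetricSpace Y] (f : ℚ_[p] → Y)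
    (hf : Continuous f) (h : ℚ_[p]) (N : ℤ) (hnorm : ‖h‖ = (p : ℝ) ^ (-N))
    (hper : ∀ x : ℚ_[p], f (x + h) = f x) :
    ∀ g : ℚ_[p], ‖g‖ ≤ (p : ℝ) ^ (-N) → ∀ x : ℚ_[p], f (x + g) = f x := by
  intro g hg x
  have hp : (0 : ℝ) < (p : ℝ) ^ (-N) :=
    zpow_pos (by exact_mod_cast (Fact.out : p.Prime).pos) _
  have hpos : 0 < ‖h‖ := hnorm ▸ hp
  have hne : h ≠ 0 := norm_pos_iff.mp hpos
  have key : ∀ z : ℤ_[p], f (x + (z : ℚ_[p]) * h) = f x := by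
    intro z
    refine DenseRange.induction_on PadicInt.denseRange_natCast z ?_ ?_
    · exact isClosed_eq (hf.comp (continuous_const.add
        (continuous_subtype_val.mul continuous_const))) continuous_const
    · intro n
      induction n with
      | zero => simp
      | succ n ih =>
        rw [← ih, ← hper (x + ((n : ℤ_[p]) : ℚ_[p]) * h)]
        congr 1
        push_cast
        ring
  have hz : ‖g / h‖ ≤ 1 := by
    rw [norm_div, div_le_one hpos, hnorm]
    exact hg
  have := key ⟨g / h, hz⟩
  simpa [div_mul_cancel₀ g hne] using this
end

section
/- (p-adic Jacobi theorem, constancy criterion) Let p be a prime, let (Y,d) be a metric space, and let f : ℚ_p → Y be continuous. Then f is constant if and only if 𝔓_0(f) contains an unbounded sequence, i.e. there exists a sequence (h_k) of periods of f with |h_k|_p → ∞. -/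
/-- p-adic Jacobi theorem (constancy criterion): a continuous `f : ℚ_p → Y`
is constant iff its set of periods contains an unbounded sequence. -/
theorem padic_jacobi_constant_iff_unbounded_periods
    (p : ℕ) [Fact p.Prime] (Y : Type*) [MetricSpace Y] (f : ℚ_[p] → Y)
    (hf : Continuous f) :
    (∃ c : Y, ∀ x : ℚ_[p], f x = c) ↔
      ∃ h : ℕ → ℚ_[p], (∀ k : ℕ, ∀ x : ℚ_[p], f (x + h k) = f x) ∧
        Filter.Tendsto (fun k => ‖h k‖) Filter.atTop Filter.atTop := by
  constructor
  · rintro ⟨c, hc⟩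
    refine ⟨fun k => ((p : ℚ_[p]) ^ k)⁻¹, fun k x => by rw [hc, hc], ?_⟩
    have h1 : (1 : ℝ) < p := by exact_mod_cast (Fact.out : p.Prime).one_lt
    have h2 := tendsto_pow_atTop_atTop_of_one_lt h1
    refine h2.congr fun k => ?_
    simp [norm_inv, norm_pow]
  · rintro ⟨h, hper, hlim⟩
    refine ⟨f 0, fun y => ?_⟩
    obtain ⟨k, hk⟩ := (hlim.eventually_ge_atTop (‖y‖ + 1)).exists
    have hpos : 0 < ‖h k‖ := by linarith [norm_nonneg y]
    have hne : h k ≠ 0 := norm_pos_iff.mp hpos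
    have hz : ‖y / h k‖ ≤ 1 := by
      rw [norm_div, div_le_one hpos]; linarith
    have hnat : ∀ n : ℕ, f ((n : ℚ_[p]) * h k) = f 0 := by
      intro n
      induction n with
      | zero => simp
      | succ n ih => rw [Nat.cast_succ, add_mul, one_mul, hper, ih]
    have key : (fun z : ℤ_[p] => f ((z : ℚ_[p]) * h k)) = fun _ => f 0 := by
      refine PadicInt.denseRange_natCast.equalizer ?_ continuous_const ?_
      · exact hf.comp (continuous_subtype_val.mul continuous_const)
      · funext n
        simpa using hnat n
    have := congrFun key ⟨y / h k, hz⟩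
    simpa [div_mul_cancel₀ y hne] using this
end

section
/- Let p be a prime, let (K,|·|_K) be a normed field together with a continuous injective ring homomorphism ι : ℚ_p → K, let m ∈ ℕ, and let f : ℚ_p → K be continuous. Suppose Δ_{h_0}^{m+1} f(x) = 0 for all x ∈ ℚ_p, where |h_0|_p = p^{-N_0} with N_0 ∈ ℤ. Then for every x_0 ∈ ℚ_p there exist constants a_0, a_1, …, a_m ∈ K such that f(x) = a_0 + a_1 ι(x) + ⋯ + a_m ι(x)^m for all x ∈ x_0 + p^{N_0} ℤ_p. -/
/-- The forward difference operator `Δ_h f (x) = f (x + h) - f x`. -/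
def fwdDiffOp {G M : Type*} [Add G] [Sub M] (h : G) (f : G → M) : G → M :=
  fun x => f (x + h) - f x

/-- If `f : ℚ_p → K` is continuous and `Δ_{h₀}^{m+1} f = 0` with `‖h₀‖_p = p^(-N₀)`,
then on every coset `x₀ + p^{N₀} ℤ_p` the function `f` coincides with a polynomial
of degree `≤ m`. -/
theorem padic_montel_local_polynomial
    (p : ℕ) [Fact p.Prime] (K : Type*) [NormedField K]
    (ι : ℚ_[p] →+* K) (hι : Function.Injective ι) (hιc : Continuous ι)
    (m : ℕ) (f : ℚ_[p] → K) (hf : Continuous f)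
    (h0 : ℚ_[p]) (N0 : ℤ) (hnorm : ‖h0‖ = (p : ℝ) ^ (-N0))
    (hΔ : ∀ x : ℚ_[p], (fwdDiffOp h0)^[m + 1] f x = 0) :
    ∀ x0 : ℚ_[p], ∃ a : Fin (m + 1) → K,
      ∀ x : ℚ_[p], ‖x - x0‖ ≤ (p : ℝ) ^ (-N0) →
        f x = ∑ i : Fin (m + 1), a i * ι x ^ (i : ℕ) := by
  intro x0
  have hD : (fwdDiffOp h0 : (ℚ_[p] → K) → ℚ_[p] → K) = fwdDiff h0 := rfl
  rw [hD] at hΔ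
  have hch : CharZero K := charZero_of_injective_ringHom hι
  have hp : (0 : ℝ) < p := by exact_mod_cast (Fact.out : p.Prime).pos
  have hh0 : h0 ≠ 0 := by
    intro h
    rw [h, norm_zero] at hnorm
    exact absurd hnorm (zpow_pos hp _).ne
  have hι0 : ι h0 ≠ 0 := by simpa using hh0
  -- higher differences vanish
  have hvan : ∀ k, m < k → (fwdDiff h0)^[k] f x0 = 0 := by
    intro k hk
    obtain ⟨j, rfl⟩ := Nat.exists_eq_add_of_le hk
    have h1 : (fwdDiff h0)^[m + 1] f = fun _ => 0 := funext hΔ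
    have h2 : ∀ j : ℕ, (fwdDiff h0)^[j] (fun _ : ℚ_[p] => (0 : K)) = fun _ => 0 := by
      intro j
      induction j with
      | zero => rfl
      | succ j ih => rw [Function.iterate_succ_apply, fwdDiff_const, ih]
    rw [show m.succ + j = j + (m + 1) by omega, Function.iterate_add_apply, h1, h2]
  let P : Polynomial K := ∑ k ∈ Finset.range (m + 1),
    Polynomial.C ((fwdDiff h0)^[k] f x0 / (k.factorial : K)) * descPochhammer K k
  let L : Polynomial K :=
    Polynomial.C (ι h0)⁻¹ * (Polynomial.X - Polynomial.C (ι x0))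
  let Q : Polynomial K := P.comp L
  have hPdeg : P.natDegree ≤ m := by
    refine Polynomial.natDegree_sum_le_of_forall_le _ _ ?_
    intro k hk
    refine (Polynomial.natDegree_C_mul_le _ _).trans ?_
    rw [descPochhammer_natDegree]
    exact Nat.lt_succ_iff.mp (Finset.mem_range.mp hk)
  have hLdeg : L.natDegree ≤ 1 :=
    (Polynomial.natDegree_C_mul_le _ _).trans (Polynomial.natDegree_X_sub_C_le _)
  have hQdeg : Q.natDegree < m + 1 := by
    have h1 : Q.natDegree ≤ P.natDegree * L.natDegree := Polynomial.natDegree_comp_le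
    have h2 : P.natDegree * L.natDegree ≤ m * 1 := Nat.mul_le_mul hPdeg hLdeg
    omega
  -- agreement on the dense progression
  have hnat : ∀ n : ℕ, f (x0 + n * h0) = Q.eval (ι (x0 + n * h0)) := by
    intro n
    have hL : L.eval (ι (x0 + n * h0)) = n := by
      simp only [L, Polynomial.eval_mul, Polynomial.eval_C, Polynomial.eval_sub,
        Polynomial.eval_X, map_add, map_mul, map_natCast]
      field_simp
      ring
    have hP : P.eval (n : K) = ∑ k ∈ Finset.range (m + 1),
        n.choose k • (fwdDiff h0)^[k] f x0 := by
      simp only [P, Polynomial.eval_finsetSum, Polynomial.eval_mul, Polynomial.eval_C]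
      refine Finset.sum_congr rfl fun k _ => ?_
      have hk : (k.factorial : K) ≠ 0 := by exact_mod_cast k.factorial_ne_zero
      rw [descPochhammer_eval_eq_descFactorial, Nat.descFactorial_eq_factorial_mul_choose,
        nsmul_eq_mul]
      push_cast
      field_simp
    have hs := shift_eq_sum_fwdDiff_iter h0 f n x0
    rw [nsmul_eq_mul] at hs
    rw [hs, Polynomial.eval_comp, hL, hP]
    rcases le_total n m with h | h
    · refine Finset.sum_subset (Finset.range_mono (by omega)) fun k _ hk => ?_
      rw [Nat.choose_eq_zero_of_lt (by simpa using hk), zero_smul]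
    · refine (Finset.sum_subset (Finset.range_mono (by omega)) fun k _ hk => ?_).symm
      rw [hvan k (by simpa using hk), smul_zero]
  have hint : ∀ z : ℤ_[p], f (x0 + z * h0) = Q.eval (ι (x0 + z * h0)) := by
    have hc : Continuous fun z : ℤ_[p] => x0 + (z : ℚ_[p]) * h0 := by fun_prop
    have := (PadicInt.denseRange_natCast (p := p)).equalizer (hf.comp hc)
      (Q.continuous.comp (hιc.comp hc)) (funext fun n => by simpa using hnat n)
    exact fun z => congrFun this z
  refine ⟨fun i => Q.coeff i, fun x hx => ?_⟩
  have hz : ‖(x - x0) / h0‖ ≤ 1 := by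
    rw [norm_div, hnorm]
    exact div_le_one_of_le₀ hx (zpow_pos hp _).le
  have h := hint ⟨(x - x0) / h0, hz⟩
  have hxx : x0 + (x - x0) / h0 * h0 = x := by field_simp; ring
  simp only [hxx] at h
  rw [h, Polynomial.eval_eq_sum_range' hQdeg, Finset.sum_range]
end

section
/- Let p be a prime, let (K,|·|_K) be a normed field together with a continuous injective ring homomorphism ι : ℚ_p → K, let m ∈ ℕ, and let f : ℚ_p → K be continuous. If h_0 ∈ 𝔓_m(f) with |h_0|_p = p^{-N} (N ∈ ℤ), then p^N ℤ_p ⊆ 𝔓_m(f). -/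
open fwdDiff_aux in
lemma fwdDiff_nsmul_iter_zero {M G : Type*} [AddCommMonoid M] [AddCommGroup G] (h : M)
    (f : M → G) (n : ℕ) (hz : (fwdDiff h)^[n] f = 0) (k : ℕ) :
    (fwdDiff (k • h))^[n] f = 0 := by
  have h1 : fwdDiffₗ M G (k • h) = shiftₗ M G h ^ k - 1 := by
    refine LinearMap.ext fun g => funext fun y => ?_
    rw [LinearMap.sub_apply, Pi.sub_apply, shiftₗ_pow_apply]
    rfl
  have h2 : fwdDiffₗ M G h = shiftₗ M G h - 1 := by
    simp only [shiftₗ, add_sub_cancel_right]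
  have h3 : fwdDiffₗ M G (k • h) =
      (∑ i ∈ Finset.range k, shiftₗ M G h ^ i) * fwdDiffₗ M G h := by
    rw [h1, h2, geom_sum_mul]
  have hc : Commute (∑ i ∈ Finset.range k, shiftₗ M G h ^ i) (fwdDiffₗ M G h) := by
    refine Commute.sum_left _ _ _ fun i _ => Commute.pow_left ?_ i
    rw [h2]
    exact (Commute.refl _).sub_right (Commute.one_right _)
  rw [← coe_fwdDiffₗ_pow, h3, hc.mul_pow, Module.End.mul_apply]
  have : (fwdDiffₗ M G h ^ n) f = 0 := by
    rw [← hz, ← coe_fwdDiffₗ_pow]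
  rw [this, map_zero]

/-- If `f : ℚ_p → K` is continuous and `h₀ ∈ 𝔓_m(f)` with `‖h₀‖_p = p^(-N)`,
then `p^N ℤ_p ⊆ 𝔓_m(f)`. -/
theorem padic_diff_period_ball_subset
    (p : ℕ) [Fact p.Prime] (K : Type*) [NormedField K]
    (ι : ℚ_[p] →+* K) (hι : Function.Injective ι) (hιc : Continuous ι)
    (m : ℕ) (f : ℚ_[p] → K) (hf : Continuous f)
    (h0 : ℚ_[p]) (N : ℤ) (hnorm : ‖h0‖ = (p : ℝ) ^ (-N))
    (hh0 : ∀ x : ℚ_[p], (fwdDiffOp h0)^[m + 1] f x = 0) :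
    ∀ h : ℚ_[p], ‖h‖ ≤ (p : ℝ) ^ (-N) →
      ∀ x : ℚ_[p], (fwdDiffOp h)^[m + 1] f x = 0 := by
  have hp : (0:ℝ) < (p : ℝ) ^ (-N) :=
    zpow_pos (by exact_mod_cast (Fact.out : p.Prime).pos) _
  have h00 : h0 ≠ 0 := by
    intro h
    rw [h, norm_zero] at hnorm
    exact hp.ne hnorm
  intro h hh x
  have hz : (fwdDiff h0)^[m + 1] f = 0 := funext hh0
  have key : ∀ z : ℤ_[p], (fwdDiff ((z : ℚ_[p]) * h0))^[m + 1] f x = 0 := by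
    intro z
    refine DenseRange.induction_on PadicInt.denseRange_natCast z ?_ ?_
    · refine isClosed_eq ?_ continuous_const
      simp only [fwdDiff_iter_eq_sum_shift]
      fun_prop
    · intro k
      have := congrFun (fwdDiff_nsmul_iter_zero h0 f (m + 1) hz k) x
      simpa [nsmul_eq_mul] using this
  have hle : ‖h / h0‖ ≤ 1 := by
    rw [norm_div, hnorm]
    exact (div_le_one hp).2 hh
  have := key ⟨h / h0, hle⟩
  rw [div_mul_cancel₀ _ h00] at this
  exact this
end

section
/- (p-adic Montel theorem, trichotomy) Let p be a prime, let (K,|·|_K) be a normed field together with a continuous injective ring homomorphism ι : ℚ_p → K, let m ∈ ℕ, and let f : ℚ_p → K be continuous. Then exactly one of the following holds: 𝔓_m(f) = {0}, or 𝔓_m(f) = ℚ_p, or there exists N ∈ ℤ such that 𝔓_m(f) = p^N ℤ_p. -/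
open fwdDiff_aux in
theorem fwdDiffOp_iter_eq {G M : Type*} [AddCommMonoid G] [AddCommGroup M] (h : G) (n : ℕ)
    (f : G → M) : (fwdDiffOp h)^[n] f = ((shiftₗ G M h - 1) ^ n) f := by
  induction n with
  | zero => rfl
  | succ n ih =>
    rw [Function.iterate_succ_apply', ih, pow_succ']
    funext x
    simp [fwdDiffOp, shiftₗ_apply]

open fwdDiff_aux in
theorem shift_nsmul {G M : Type*} [AddCommMonoid G] [AddCommGroup M] (h : G) (k : ℕ) :
    shiftₗ G M (k • h) = (shiftₗ G M h) ^ k := by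
  ext f x
  rw [shiftₗ_pow_apply, shiftₗ_apply]

open fwdDiff_aux in
theorem fwdDiffOp_nsmul {G M : Type*} [AddCommMonoid G] [AddCommGroup M] (h : G) (n k : ℕ)
    (f : G → M) (H : (fwdDiffOp h)^[n] f = 0) : (fwdDiffOp (k • h))^[n] f = 0 := by
  rw [fwdDiffOp_iter_eq] at H ⊢
  rw [shift_nsmul, ← geom_sum_mul, Commute.mul_pow, Module.End.mul_apply, H, map_zero]
  refine Commute.sum_left _ _ _ fun i _ => ?_
  exact ((Commute.refl _).pow_left i).sub_right (Commute.one_right _)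

theorem fwdDiffOp_cont {C G M : Type*} [TopologicalSpace C] [TopologicalSpace G] [Add G]
    [ContinuousAdd G] [AddCommGroup M] [TopologicalSpace M] [IsTopologicalAddGroup M]
    (u : C → G) (hu : Continuous u) (f : G → M) (hf : Continuous f) (n : ℕ) :
    Continuous (fun q : C × G => (fwdDiffOp (u q.1))^[n] f q.2) := by
  induction n with
  | zero => exact hf.comp continuous_snd
  | succ n ih =>
    simp only [Function.iterate_succ_apply', fwdDiffOp]
    refine Continuous.sub ?_ ih
    exact ih.comp (f := fun q : C × G => (q.1, q.2 + u q.1)) (by fun_prop)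

theorem fwdDiffOp_ball {p : ℕ} [Fact p.Prime] {K : Type*} [NormedField K] (n : ℕ)
    (f : ℚ_[p] → K) (hf : Continuous f) (h g : ℚ_[p]) (hg : ‖g‖ ≤ ‖h‖)
    (H : ∀ x, (fwdDiffOp h)^[n] f x = 0) (x : ℚ_[p]) : (fwdDiffOp g)^[n] f x = 0 := by
  rcases eq_or_ne h 0 with rfl | h0
  · have : g = 0 := by simpa using hg
    subst this
    exact H x
  have key : ∀ z : ℤ_[p], (fwdDiffOp ((z : ℚ_[p]) * h))^[n] f x = 0 := by
    have hc : Continuous (fun z : ℤ_[p] => (fwdDiffOp ((z : ℚ_[p]) * h))^[n] f x) :=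
      (fwdDiffOp_cont (fun z : ℤ_[p] => (z : ℚ_[p]) * h)
        (continuous_subtype_val.mul continuous_const) f hf n).comp
        (Continuous.prodMk continuous_id continuous_const)
    have := PadicInt.denseRange_natCast (p := p) |>.equalizer hc (continuous_const (y := (0 : K)))
      (by
        funext k
        have := congrFun (fwdDiffOp_nsmul h n k f (funext H)) x
        simpa [nsmul_eq_mul] using this)
    exact fun z => congrFun this z
  have hz : ‖g / h‖ ≤ 1 := by
    rw [norm_div]
    exact div_le_one_of_le₀ hg (norm_nonneg _)
  have := key ⟨g / h, hz⟩
  simpa [div_mul_cancel₀ _ h0] using this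

/-- p-adic Montel theorem (trichotomy): for a continuous `f : ℚ_p → K`,
the set `𝔓_m(f) = {h : Δ_h^{m+1} f = 0}` is either `{0}`, all of `ℚ_p`,
or `p^N ℤ_p` for some `N ∈ ℤ`. -/
theorem padic_montel_trichotomy
    (p : ℕ) [Fact p.Prime] (K : Type*) [NormedField K]
    (ι : ℚ_[p] →+* K) (hι : Function.Injective ι) (hιc : Continuous ι)
    (m : ℕ) (f : ℚ_[p] → K) (hf : Continuous f) :
    {h : ℚ_[p] | ∀ x : ℚ_[p], (fwdDiffOp h)^[m + 1] f x = 0} = {0} ∨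
      {h : ℚ_[p] | ∀ x : ℚ_[p], (fwdDiffOp h)^[m + 1] f x = 0} = Set.univ ∨
      ∃ N : ℤ, {h : ℚ_[p] | ∀ x : ℚ_[p], (fwdDiffOp h)^[m + 1] f x = 0}
        = {h : ℚ_[p] | ‖h‖ ≤ (p : ℝ) ^ (-N)} := by
  have ball := fun h g hg H => fwdDiffOp_ball (p := p) (m + 1) f hf h g hg H
  set S := {h : ℚ_[p] | ∀ x : ℚ_[p], (fwdDiffOp h)^[m + 1] f x = 0} with hS
  replace ball : ∀ h g : ℚ_[p], ‖g‖ ≤ ‖h‖ → h ∈ S → g ∈ S := ball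
  have h0 : (0 : ℚ_[p]) ∈ S := by
    intro x
    rw [Function.iterate_succ_apply']
    simp [fwdDiffOp]
  have hp : (1 : ℝ) < p := by exact_mod_cast (Fact.out : p.Prime).one_lt
  by_cases hne : ∃ h ∈ S, h ≠ 0
  swap
  · left
    push Not at hne
    ext h
    exact ⟨fun hh => hne h hh, fun hh => by rw [Set.mem_singleton_iff.1 hh]; exact h0⟩
  right
  obtain ⟨h1, h1S, h1n⟩ := hne
  by_cases hb : ∃ b : ℤ, ∀ z : ℤ, (∃ h ∈ S, h ≠ 0 ∧ h.valuation = z) → b ≤ z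
  · right
    obtain ⟨N, ⟨h, hhS, hh0, hN⟩, hmin⟩ := Int.exists_least_of_bdd hb ⟨_, h1, h1S, h1n, rfl⟩
    have hnorm : ‖h‖ = (p : ℝ) ^ (-N) := by rw [Padic.norm_eq_zpow_neg_valuation hh0, hN]
    refine ⟨N, ?_⟩
    ext g
    refine ⟨fun hg => ?_, fun hg => ball h g (hnorm ▸ hg) hhS⟩
    rcases eq_or_ne g 0 with rfl | hg0
    · simp only [Set.mem_setOf_eq, norm_zero]
      positivity
    · have := hmin _ ⟨g, hg, hg0, rfl⟩
      rw [Set.mem_setOf_eq, Padic.norm_eq_zpow_neg_valuation hg0]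
      exact zpow_le_zpow_right₀ hp.le (by omega)
  · left
    push Not at hb
    refine Set.eq_univ_of_forall fun g => ?_
    rcases eq_or_ne g 0 with rfl | hg0
    · exact h0
    obtain ⟨z, ⟨h, hhS, hh0, hz⟩, hlt⟩ := hb g.valuation
    refine ball h g ?_ hhS
    rw [Padic.norm_eq_zpow_neg_valuation hg0, Padic.norm_eq_zpow_neg_valuation hh0]
    exact zpow_le_zpow_right₀ hp.le (by omega)
end

section
/- (p-adic Montel theorem, polynomial criterion) Let p be a prime, let (K,|·|_K) be a normed field together with a continuous injective ring homomorphism ι : ℚ_p → K, let m ∈ ℕ, and let f : ℚ_p → K be continuous. Then there exist a_0, a_1, …, a_m ∈ K with f(x) = a_0 + a_1 ι(x) + ⋯ + a_m ι(x)^m for all x ∈ ℚ_p if and only if 𝔓_m(f) contains an unbounded sequence, i.e. there exist h_k ∈ 𝔓_m(f) with |h_k|_p → ∞. -/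
open Polynomial in
/-- Newton interpolation along the progression `n • h`, extended by density to the ball. -/
theorem montel_local (p : ℕ) [Fact p.Prime] (K : Type*) [NormedField K] [CharZero K]
    (ι : ℚ_[p] →+* K) (hιc : Continuous ι)
    (m : ℕ) (f : ℚ_[p] → K) (hf : Continuous f) (h : ℚ_[p]) (h0 : h ≠ 0)
    (hh : ∀ x : ℚ_[p], (fwdDiffOp h)^[m + 1] f x = 0) :
    ∃ Q : K[X], Q.natDegree < m + 1 ∧ ∀ y : ℚ_[p], ‖y‖ ≤ ‖h‖ → f y = Q.eval (ι y) := by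
  have hop : (fwdDiffOp h : (ℚ_[p] → K) → (ℚ_[p] → K)) = fwdDiff h := rfl
  rw [hop] at hh
  have hz : ∀ k, m + 1 ≤ k → ∀ x, (fwdDiff h)^[k] f x = 0 := by
    intro k hk
    induction k, hk using Nat.le_induction with
    | base => exact hh
    | succ k hk ih =>
      intro x
      rw [Function.iterate_succ_apply']
      simp [fwdDiff, ih]
  let P : K[X] := ∑ k ∈ Finset.range (m + 1),
    C ((fwdDiff h)^[k] f 0 / (k.factorial : K)) * descPochhammer K k
  have hPd : P.natDegree ≤ m := by
    apply natDegree_sum_le_of_forall_le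
    intro k hk
    refine (natDegree_C_mul_le _ _).trans ?_
    rw [descPochhammer_natDegree]
    exact Nat.lt_succ_iff.mp (Finset.mem_range.mp hk)
  have hPn : ∀ n : ℕ, f ((n : ℚ_[p]) * h) = P.eval (n : K) := by
    intro n
    have e1 := shift_eq_sum_fwdDiff_iter h f n 0
    rw [zero_add, nsmul_eq_mul] at e1
    have e2 : ∀ N, n + 1 ≤ N → f ((n : ℚ_[p]) * h) =
        ∑ k ∈ Finset.range N, n.choose k • (fwdDiff h)^[k] f 0 := by
      intro N hN
      rw [e1]
      apply Finset.sum_subset (Finset.range_mono hN)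
      intro k _ hk
      rw [Finset.mem_range, not_lt] at hk
      rw [Nat.choose_eq_zero_of_lt (by omega), zero_smul]
    rw [e2 (max (n + 1) (m + 1)) (le_max_left _ _), eval_finsetSum]
    symm
    rw [← Finset.sum_subset (Finset.range_mono (le_max_right (n + 1) (m + 1)))]
    · refine Finset.sum_congr rfl fun k _ => ?_
      rw [eval_mul, eval_C, descPochhammer_eval_eq_descFactorial,
        Nat.descFactorial_eq_factorial_mul_choose, nsmul_eq_mul]
      have : (k.factorial : K) ≠ 0 := by exact_mod_cast k.factorial_ne_zero
      push_cast
      field_simp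
    · intro k _ hk
      rw [Finset.mem_range, not_lt] at hk
      rw [hz k hk, smul_zero]
  have hPz : ∀ z : ℤ_[p], f ((z : ℚ_[p]) * h) = P.eval (ι (z : ℚ_[p])) := by
    have hc1 : Continuous fun z : ℤ_[p] => f ((z : ℚ_[p]) * h) :=
      hf.comp (continuous_subtype_val.mul continuous_const)
    have hc2 : Continuous fun z : ℤ_[p] => P.eval (ι (z : ℚ_[p])) :=
      P.continuous.comp (hιc.comp continuous_subtype_val)
    have := PadicInt.denseRange_natCast.equalizer hc1 hc2 (by
      funext n
      simp [hPn])
    exact fun z => congrFun this z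
  refine ⟨P.comp (C (ι h)⁻¹ * X), ?_, ?_⟩
  · refine Nat.lt_succ_of_le (natDegree_comp_le.trans ?_)
    calc P.natDegree * (C (ι h)⁻¹ * X).natDegree ≤ m * 1 :=
          Nat.mul_le_mul hPd ((natDegree_C_mul_le _ _).trans natDegree_X_le)
      _ = m := mul_one m
  · intro y hy
    have hn : ‖y / h‖ ≤ 1 := by
      rw [norm_div]
      exact div_le_one_of_le₀ hy (norm_nonneg _)
    have e := hPz ⟨y / h, hn⟩
    simp only [div_mul_cancel₀ _ h0] at e
    rw [e]
    rw [eval_comp, eval_mul, eval_C, eval_X, map_div₀, div_eq_mul_inv, mul_comm]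

open Polynomial in
/-- Polynomials of degree at most `m` are killed by `Δ_h^{m+1}`. -/
theorem montel_easy (p : ℕ) [Fact p.Prime] (K : Type*) [NormedField K]
    (ι : ℚ_[p] →+* K) (m : ℕ) (P : K[X]) (hP : P.natDegree ≤ m) (h x : ℚ_[p]) :
    (fwdDiffOp h)^[m + 1] (fun y => P.eval (ι y)) x = 0 := by
  have hop : (fwdDiffOp h : (ℚ_[p] → K) → (ℚ_[p] → K)) = fwdDiff h := rfl
  rw [hop, fwdDiff_iter_eq_sum_shift]
  let Q : K[X] := P.comp (C (ι h) * X + C (ι x))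
  have hQ : Q.natDegree < m + 1 := by
    refine Nat.lt_succ_of_le (natDegree_comp_le.trans ?_)
    calc P.natDegree * (C (ι h) * X + C (ι x)).natDegree ≤ m * 1 :=
          Nat.mul_le_mul hP natDegree_linear_le
      _ = m := mul_one m
  have := congrFun (Polynomial.fwdDiff_iter_eq_zero_of_degree_lt hQ) 0
  rw [fwdDiff_iter_eq_sum_shift, Pi.zero_apply] at this
  rw [← this]
  refine Finset.sum_congr rfl fun k _ => ?_
  congr 1
  simp only [Q, eval_comp, eval_add, eval_mul, eval_C, eval_X, nsmul_eq_mul, map_add, map_mul,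
    map_natCast, mul_one, zero_add]
  congr 1
  ring

/-- p-adic Montel theorem (polynomial criterion): a continuous `f : ℚ_p → K`
is a polynomial of degree `≤ m` iff `𝔓_m(f)` contains an unbounded sequence. -/
theorem padic_montel_polynomial_iff_unbounded
    (p : ℕ) [Fact p.Prime] (K : Type*) [NormedField K]
    (ι : ℚ_[p] →+* K) (hι : Function.Injective ι) (hιc : Continuous ι)
    (m : ℕ) (f : ℚ_[p] → K) (hf : Continuous f) :
    (∃ a : Fin (m + 1) → K, ∀ x : ℚ_[p],
        f x = ∑ i : Fin (m + 1), a i * ι x ^ (i : ℕ)) ↔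
      ∃ h : ℕ → ℚ_[p],
        (∀ k : ℕ, ∀ x : ℚ_[p], (fwdDiffOp (h k))^[m + 1] f x = 0) ∧
        Filter.Tendsto (fun k => ‖h k‖) Filter.atTop Filter.atTop := by
  classical
  have : CharZero K := charZero_of_injective_ringHom hι
  constructor
  · rintro ⟨a, ha⟩
    refine ⟨fun k => ((p : ℚ_[p]) ^ k)⁻¹, ?_, ?_⟩
    · intro k x
      let P : Polynomial K := ∑ i : Fin (m + 1), Polynomial.C (a i) * Polynomial.X ^ (i : ℕ)
      have hP : P.natDegree ≤ m := by
        apply Polynomial.natDegree_sum_le_of_forall_le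
        intro i _
        exact (Polynomial.natDegree_C_mul_X_pow_le _ _).trans (Nat.lt_succ_iff.mp i.2)
      have hfe : f = fun y => P.eval (ι y) := by
        funext y
        rw [ha, Polynomial.eval_finsetSum]
        simp
      rw [hfe]
      exact montel_easy p K ι m P hP _ x
    · have hp : (1 : ℝ) < p := by exact_mod_cast (Fact.out : p.Prime).one_lt
      simpa using tendsto_pow_atTop_atTop_of_one_lt hp
  · rintro ⟨h, hh, ht⟩
    have hloc : ∀ k, 1 ≤ ‖h k‖ → ∃ Q : Polynomial K, Q.natDegree < m + 1 ∧
        ∀ y : ℚ_[p], ‖y‖ ≤ ‖h k‖ → f y = Q.eval (ι y) := by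
      intro k hk
      refine montel_local p K ι hιc m f hf (h k) ?_ (hh k)
      intro h0
      rw [h0, norm_zero] at hk
      linarith
    obtain ⟨k₀, hk₀⟩ := (ht.eventually_ge_atTop 1).exists
    obtain ⟨Q, hQd, hQ⟩ := hloc k₀ hk₀
    refine ⟨fun i => Q.coeff i, fun x => ?_⟩
    obtain ⟨k, hk⟩ := (ht.eventually_ge_atTop (max 1 ‖x‖)).exists
    have hk1 := (le_max_left _ _).trans hk
    obtain ⟨R, hRd, hR⟩ := hloc k hk1
    have hRQ : R = Q := by
      apply Polynomial.eq_of_infinite_eval_eq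
      refine (Set.infinite_range_of_injective (Nat.cast_injective (R := K))).mono ?_
      rintro _ ⟨n, rfl⟩
      have hn : ‖(n : ℚ_[p])‖ ≤ 1 := by
        simpa using Padic.norm_int_le_one (p := p) (n : ℤ)
      have e1 := hR n (hn.trans hk1)
      have e2 := hQ n (hn.trans hk₀)
      rw [map_natCast] at e1 e2
      exact e1.symm.trans e2
    rw [hR x ((le_max_right _ _).trans hk), hRQ, Polynomial.eval_eq_sum_range' hQd,
      Finset.sum_range]
end

section
/- Let p be a prime, let (K,|·|_K) be a normed field together with a continuous injective ring homomorphism ι : ℚ_p → K, let m ∈ ℕ, and let f : ℚ_p → K be continuous. Then f is uniformly locally an ordinary polynomial of degree ≤ m (i.e. there exists r > 0 such that for every x_0 ∈ ℚ_p there are a_0,…,a_m ∈ K with f(x) = a_0 + a_1 ι(x) + ⋯ + a_m ι(x)^m for all x with |x − x_0|_p ≤ r) if and only if 𝔓_m(f) ≠ {0}. -/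
open Polynomial in
/-- A polynomial precomposed with an affine map has degree at most the original one. -/
lemma natDegree_comp_affine_le {K : Type*} [Field K] (P : K[X]) (a b : K) (m : ℕ)
    (hP : P.natDegree ≤ m) : (P.comp (C a + C b * X)).natDegree ≤ m := by
  refine natDegree_comp_le.trans ?_
  have h1 : (C a + C b * X : K[X]).natDegree ≤ 1 := by
    rw [add_comm]; exact natDegree_linear_le
  calc _ ≤ P.natDegree * 1 := Nat.mul_le_mul_left _ h1
    _ ≤ m := by simpa using hP

open Polynomial in
/-- Newton interpolation: the values `f (x + n h)` are those of a polynomial of degree `≤ m`. -/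
lemma exists_newton_poly {G K : Type*} [AddCommGroup G] [Field K] [CharZero K] (f : G → K)
    (h : G) (m : ℕ) (hh : ∀ x, (fwdDiff h)^[m + 1] f x = 0) (x : G) :
    ∃ P : K[X], P.natDegree ≤ m ∧ ∀ n : ℕ, f (x + n • h) = P.eval (n : K) := by
  refine ⟨∑ k ∈ Finset.range (m + 1),
    C ((fwdDiff h)^[k] f x / (k.factorial : K)) * descPochhammer K k, ?_, ?_⟩
  · refine natDegree_sum_le_of_forall_le _ _ fun k hk => ?_
    refine (natDegree_C_mul_le _ _).trans ?_
    rw [descPochhammer_natDegree]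
    exact Nat.lt_succ_iff.mp (Finset.mem_range.mp hk)
  · intro n
    have hz : ∀ k, m + 1 ≤ k → (fwdDiff h)^[k] f x = 0 := by
      intro k hk
      obtain ⟨j, rfl⟩ := Nat.exists_eq_add_of_le' hk
      have h0 : (fwdDiff h)^[m + 1] f = fun _ => 0 := funext hh
      rw [Function.iterate_add_apply, h0, fwdDiff_iter_eq_sum_shift]
      simp
    rw [shift_eq_sum_fwdDiff_iter h f n x, eval_finsetSum]
    have e1 : ∑ k ∈ Finset.range (n + 1), n.choose k • (fwdDiff h)^[k] f x
        = ∑ k ∈ Finset.range (n + 1 + (m + 1)), n.choose k • (fwdDiff h)^[k] f x := by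
      refine Finset.sum_subset (by simp) fun k _ hk => ?_
      rw [Nat.choose_eq_zero_of_lt (by simpa using hk), zero_smul]
    have e2 : ∑ k ∈ Finset.range (m + 1), n.choose k • (fwdDiff h)^[k] f x
        = ∑ k ∈ Finset.range (n + 1 + (m + 1)), n.choose k • (fwdDiff h)^[k] f x := by
      refine Finset.sum_subset (by simp) fun k _ hk => ?_
      rw [hz k (by simpa using hk), smul_zero]
    rw [e1, ← e2]
    refine Finset.sum_congr rfl fun k _ => ?_
    rw [eval_mul, eval_C, descPochhammer_eval_eq_descFactorial,
      Nat.descFactorial_eq_factorial_mul_choose]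
    have : (k.factorial : K) ≠ 0 := by exact_mod_cast k.factorial_ne_zero
    push_cast
    rw [nsmul_eq_mul]
    field_simp

open Polynomial in
/-- A continuous `f : ℚ_p → K` is uniformly locally an ordinary polynomial of
degree `≤ m` iff `𝔓_m(f) ≠ {0}`. -/
theorem padic_uniformly_locally_polynomial_iff
    (p : ℕ) [Fact p.Prime] (K : Type*) [NormedField K]
    (ι : ℚ_[p] →+* K) (hι : Function.Injective ι) (hιc : Continuous ι)
    (m : ℕ) (f : ℚ_[p] → K) (hf : Continuous f) :
    (∃ r : ℝ, 0 < r ∧ ∀ x0 : ℚ_[p], ∃ a : Fin (m + 1) → K,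
        ∀ x : ℚ_[p], ‖x - x0‖ ≤ r → f x = ∑ i : Fin (m + 1), a i * ι x ^ (i : ℕ)) ↔
      {h : ℚ_[p] | ∀ x : ℚ_[p], (fwdDiffOp h)^[m + 1] f x = 0} ≠ {0} := by
  have hop : ∀ h : ℚ_[p], (fwdDiffOp h : (ℚ_[p] → K) → _) = fwdDiff h := fun _ => rfl
  simp only [hop]
  have : CharZero K := charZero_of_injective_ringHom hι
  constructor
  · rintro ⟨r, hr, H⟩ heq
    obtain ⟨h, hh0, hhr⟩ := NormedField.exists_norm_lt ℚ_[p] hr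
    have hmem : h ∈ {h : ℚ_[p] | ∀ x : ℚ_[p], (fwdDiff h)^[m + 1] f x = 0} := by
      intro x
      obtain ⟨a, ha⟩ := H x
      set P : K[X] := ∑ i : Fin (m + 1), C (a i) * X ^ (i : ℕ) with hPdef
      have hP : P.natDegree ≤ m := by
        refine natDegree_sum_le_of_forall_le _ _ fun i _ => ?_
        exact (natDegree_C_mul_X_pow_le _ _).trans (Nat.lt_succ_iff.mp i.2)
      have hR := natDegree_comp_affine_le P (ι x) (ι h) m hP
      have h0 := congr_fun
        (Polynomial.fwdDiff_iter_eq_zero_of_degree_lt (Nat.lt_succ_iff.mpr hR)) 0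
      rw [fwdDiff_iter_eq_sum_shift] at h0 ⊢
      rw [Pi.zero_apply] at h0
      rw [← h0]
      refine Finset.sum_congr rfl fun k _ => ?_
      congr 1
      have hk : ‖x + k • h - x‖ ≤ r := by
        rw [add_sub_cancel_left, nsmul_eq_mul, norm_mul]
        have : ‖(k : ℚ_[p])‖ ≤ 1 := by simpa using Padic.norm_int_le_one (p := p) (k : ℤ)
        nlinarith [norm_nonneg h]
      rw [ha _ hk, hPdef]
      simp only [eval_comp, eval_finsetSum, eval_mul, eval_C, eval_pow, eval_X, eval_add, map_add,
        nsmul_eq_mul, map_mul, map_natCast, zero_add, mul_one, mul_comm (ι h)]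
    rw [heq] at hmem
    simp only [Set.mem_singleton_iff] at hmem
    simp [hmem] at hh0
  · intro hne
    have h0mem : (0 : ℚ_[p]) ∈ {h : ℚ_[p] | ∀ x : ℚ_[p], (fwdDiff h)^[m + 1] f x = 0} := by
      intro x
      rw [Function.iterate_succ_apply']
      simp [fwdDiff]
    have : ∃ h : ℚ_[p], (∀ x, (fwdDiff h)^[m + 1] f x = 0) ∧ h ≠ 0 := by
      by_contra! hcon
      exact hne (Set.eq_singleton_iff_unique_mem.mpr ⟨h0mem, fun h hh => hcon h hh⟩)
    obtain ⟨h, hh, hh0⟩ := this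
    refine ⟨‖h‖, norm_pos_iff.mpr hh0, fun x0 => ?_⟩
    obtain ⟨P, hP, hPv⟩ := exists_newton_poly f h m hh x0
    have hιh : ι h ≠ 0 := (map_ne_zero ι).mpr hh0
    have key : (fun y : ℤ_[p] => f (x0 + (y : ℚ_[p]) * h)) = fun y : ℤ_[p] => P.eval (ι y) := by
      refine PadicInt.denseRange_natCast.equalizer ?_ ?_ ?_
      · exact hf.comp (by fun_prop)
      · exact P.continuous.comp (hιc.comp continuous_subtype_val)
      · funext n
        simpa using hPv n
    set Q : K[X] := P.comp (C (-(ι x0 / ι h)) + C (ι h)⁻¹ * X) with hQ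
    have hQd : Q.natDegree ≤ m := natDegree_comp_affine_le P _ _ m hP
    refine ⟨fun i => Q.coeff i, fun x hx => ?_⟩
    rw [Fin.sum_univ_eq_sum_range (fun i => Q.coeff i * ι x ^ i) (m + 1),
      ← eval_eq_sum_range' (Nat.lt_succ_iff.mpr hQd)]
    have hy : ‖(x - x0) / h‖ ≤ 1 := by
      rw [norm_div]
      exact div_le_one_of_le₀ hx (norm_nonneg _)
    have hk := congr_fun key ⟨(x - x0) / h, hy⟩
    simp only at hk
    rw [div_mul_cancel₀ _ hh0, add_sub_cancel] at hk
    rw [hk, hQ, eval_comp]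
    congr 1
    simp only [map_div₀, map_sub, eval_add, eval_C, eval_mul, eval_X]
    field_simp
    ring
end

section
/- Let p be a prime and m ∈ ℕ. There exists a continuous function f : ℚ_p → ℚ_p which is locally an ordinary polynomial of degree ≤ m (i.e. for every x_0 ∈ ℚ_p there exist r > 0 and a_0,…,a_m ∈ ℚ_p with f(x) = a_0 + a_1 x + ⋯ + a_m x^m for all x with |x − x_0|_p ≤ r), but whose set 𝔓_m(f) equals {0}; in particular f is not uniformly locally an ordinary polynomial. One such function is f(x) = p^n x^m for x ∈ p^{-n} + p^n ℤ_p (n ∈ ℕ) and f(x) = 0 for x outside ⋃_{n≥0}(p^{-n} + p^n ℤ_p). -/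
namespace PadicLP

variable {p : ℕ} [hp : Fact p.Prime]

/-- `x` lies in `p^(-n) + p^n ℤ_p`. -/
def InB (p : ℕ) [Fact p.Prime] (n : ℕ) (x : ℚ_[p]) : Prop :=
  ‖x - (p : ℚ_[p]) ^ (-(n : ℤ))‖ ≤ (p : ℝ) ^ (-(n : ℤ))

lemma one_lt : (1 : ℝ) < p := by exact_mod_cast hp.out.one_lt

lemma norm_c (n : ℕ) : ‖(p : ℚ_[p]) ^ (-(n : ℤ))‖ = (p : ℝ) ^ n := by
  rw [Padic.norm_p_zpow]; simp

lemma rad_le (n : ℕ) : (p : ℝ) ^ (-(n : ℤ)) ≤ 1 :=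
  zpow_le_one_of_nonpos₀ one_lt.le (by simp)

lemma one_le_pow (n : ℕ) : (1 : ℝ) ≤ (p : ℝ) ^ n := one_le_pow₀ one_lt.le

lemma add_le {a b : ℚ_[p]} {C : ℝ} (ha : ‖a‖ ≤ C) (hb : ‖b‖ ≤ C) : ‖a + b‖ ≤ C :=
  (Padic.nonarchimedean a b).trans (max_le ha hb)

lemma InB.max_eq {n : ℕ} {x : ℚ_[p]} (h : InB p n x) : max ‖x‖ 1 = (p : ℝ) ^ n := by
  unfold InB at h
  have h1 := h.trans (rad_le n)
  apply le_antisymm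
  · refine max_le ?_ (one_le_pow n)
    have := add_le (h1.trans (one_le_pow (p := p) n)) (norm_c (p := p) n).le
    simpa using this
  · rw [← norm_c]
    have h2 : ‖-(x - (p : ℚ_[p]) ^ (-(n : ℤ)))‖ ≤ max ‖x‖ 1 := by
      rw [norm_neg]; exact h1.trans (le_max_right _ _)
    have := add_le (le_max_left ‖x‖ 1) h2
    simpa using this

lemma pow_inj {n k : ℕ} (h : (p : ℝ) ^ n = (p : ℝ) ^ k) : n = k :=
  pow_right_injective₀ (by linarith [one_lt (p := p)]) (one_lt (p := p)).ne' h

lemma InB.unique {n k : ℕ} {x : ℚ_[p]} (h : InB p n x) (h' : InB p k x) : n = k :=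
  pow_inj (p := p) (h.max_eq.symm.trans h'.max_eq)

open Classical in
/-- The function. -/
noncomputable def F (p : ℕ) [Fact p.Prime] (m : ℕ) (x : ℚ_[p]) : ℚ_[p] :=
  if h : ∃ n, InB p n x then (p : ℚ_[p]) ^ h.choose * x ^ m else 0

lemma F_in {m n : ℕ} {x : ℚ_[p]} (h : InB p n x) : F p m x = (p : ℚ_[p]) ^ n * x ^ m := by
  have h' : ∃ n, InB p n x := ⟨n, h⟩
  rw [F, dif_pos h', h'.choose_spec.unique h]

lemma F_out {m : ℕ} {x : ℚ_[p]} (h : ∀ n, ¬ InB p n x) : F p m x = 0 := by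
  rw [F, dif_neg (by simpa using h)]

lemma norm_key {n : ℕ} {h : ℚ_[p]} (h2 : ‖h‖ < (p : ℝ) ^ n) :
    ‖(p : ℚ_[p]) ^ (-(n : ℤ)) + h‖ = (p : ℝ) ^ n := by
  rw [IsUltrametricDist.norm_add_eq_max_of_norm_ne_norm, norm_c, max_eq_left h2.le]
  rw [norm_c]; exact h2.ne'

lemma F_key {m n : ℕ} {h : ℚ_[p]} (h1 : (p : ℝ) ^ (-(n : ℤ)) < ‖h‖) (h2 : ‖h‖ < (p : ℝ) ^ n) :
    F p m ((p : ℚ_[p]) ^ (-(n : ℤ)) + h) = 0 := by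
  apply F_out
  intro k hk
  have := hk.max_eq
  rw [norm_key h2, max_eq_left (one_le_pow n)] at this
  have := pow_inj this
  subst this
  unfold InB at hk
  rw [add_sub_cancel_left] at hk
  linarith

lemma val_ne {m n : ℕ} {h : ℚ_[p]} (h2 : ‖h‖ < (p : ℝ) ^ n) :
    (p : ℚ_[p]) ^ n * ((p : ℚ_[p]) ^ (-(n : ℤ)) + h) ^ m ≠ 0 := by
  have hp0 : (p : ℚ_[p]) ≠ 0 := by exact_mod_cast hp.out.ne_zero
  have : (p : ℚ_[p]) ^ (-(n : ℤ)) + h ≠ 0 := by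
    rw [← norm_pos_iff, norm_key h2]
    linarith [one_le_pow (p := p) n]
  exact mul_ne_zero (pow_ne_zero _ hp0) (pow_ne_zero _ this)

lemma F_local (m : ℕ) (x0 : ℚ_[p]) : ∃ r : ℝ, 0 < r ∧ ∃ a : Fin (m + 1) → ℚ_[p],
    ∀ x : ℚ_[p], ‖x - x0‖ ≤ r → F p m x = ∑ i : Fin (m + 1), a i * x ^ (i : ℕ) := by
  have pp : (0 : ℝ) < p := by linarith [one_lt (p := p)]
  by_cases h : ∃ n, InB p n x0
  · obtain ⟨n, hn⟩ := h
    refine ⟨(p : ℝ) ^ (-(n : ℤ)), by positivity,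
      Pi.single (Fin.last m) ((p : ℚ_[p]) ^ n), fun x hx => ?_⟩
    have hx' : InB p n x := by
      have := add_le hx hn
      simpa [InB] using this
    rw [F_in hx', Finset.sum_eq_single (Fin.last m)]
    · simp
    · intro b _ hb; simp [hb]
    · simp
  · push Not at h
    obtain ⟨K, hK⟩ := pow_unbounded_of_one_lt ‖x0‖ (one_lt (p := p))
    refine ⟨(p : ℝ) ^ (-(K : ℤ)), by positivity, 0, fun x hx => ?_⟩
    simp only [Pi.zero_apply, zero_mul, Finset.sum_const_zero]
    apply F_out
    intro n hn
    have h1 : ‖x‖ ≤ (p : ℝ) ^ K := by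
      have := add_le ((hx.trans (rad_le K)).trans (one_le_pow K)) hK.le
      simpa using this
    have h2 : (p : ℝ) ^ n ≤ (p : ℝ) ^ K := hn.max_eq ▸ max_le h1 (one_le_pow K)
    have h3 : n ≤ K := (pow_le_pow_iff_right₀ (one_lt (p := p))).1 h2
    have h4 : (p : ℝ) ^ (-(K : ℤ)) ≤ (p : ℝ) ^ (-(n : ℤ)) :=
      zpow_le_zpow_right₀ (one_lt (p := p)).le (by lia)
    refine h n ?_
    have := add_le (norm_sub_rev x x0 ▸ hx.trans h4) hn
    simpa [InB] using this

lemma F_cont (m : ℕ) : Continuous (F p m) := by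
  rw [continuous_iff_continuousAt]
  intro x0
  obtain ⟨r, hr, a, ha⟩ := F_local m x0
  have hc : ContinuousAt (fun x : ℚ_[p] => ∑ i : Fin (m + 1), a i * x ^ (i : ℕ)) x0 := by
    fun_prop
  refine hc.congr ?_
  filter_upwards [Metric.closedBall_mem_nhds x0 hr] with x hx
  exact (ha x (by simpa [dist_eq_norm] using hx)).symm

lemma tends (n : ℕ) (h : ℚ_[p]) : ∃ N : ℕ, ∀ t : ℕ,
    ‖((p ^ N * t : ℕ) : ℚ_[p]) * h‖ ≤ (p : ℝ) ^ (-(n : ℤ)) := by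
  have pp : (0 : ℝ) < p := by linarith [one_lt (p := p)]
  obtain ⟨K, hK⟩ := pow_unbounded_of_one_lt ‖h‖ (one_lt (p := p))
  refine ⟨K + n, fun t => ?_⟩
  have ht : ‖(t : ℚ_[p])‖ ≤ 1 := by simpa using Padic.norm_int_le_one (p := p) (t : ℤ)
  push_cast
  rw [norm_mul, norm_mul, Padic.norm_p_pow]
  calc (p : ℝ) ^ (-((K + n : ℕ) : ℤ)) * ‖(t : ℚ_[p])‖ * ‖h‖
      ≤ (p : ℝ) ^ (-((K + n : ℕ) : ℤ)) * 1 * (p : ℝ) ^ K := by gcongr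
    _ = (p : ℝ) ^ (-(n : ℤ)) := by
      rw [mul_one, ← zpow_natCast (p : ℝ) K, ← zpow_add₀ pp.ne']
      congr 1; push_cast; ring

open Polynomial in
lemma poly_choose (h : ℚ_[p]) (f : ℚ_[p] → ℚ_[p]) (m : ℕ) (x : ℚ_[p])
    (H : ∀ x, (fwdDiffOp h)^[m + 1] f x = 0) :
    ∃ Q : ℚ_[p][X], ∀ k : ℕ, f (x + k * h) = Q.eval (k : ℚ_[p]) := by
  have H' : ∀ x, (fwdDiff h)^[m + 1] f x = 0 := H
  have Hz : ∀ j, m + 1 ≤ j → (fwdDiff h)^[j] f x = 0 := by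
    intro j hj
    obtain ⟨d, rfl⟩ := Nat.exists_eq_add_of_le hj
    rw [add_comm, Function.iterate_add_apply]
    have : (fwdDiff h)^[m + 1] f = 0 := funext H'
    rw [this]
    have h0 : ∀ d, (fwdDiff h)^[d] (0 : ℚ_[p] → ℚ_[p]) = 0 := by
      intro d
      apply Function.iterate_fixed
      funext y; simp [fwdDiff]
    rw [h0]; rfl
  refine ⟨∑ j ∈ Finset.range (m + 1), C ((fwdDiff h)^[j] f x / (j.factorial : ℚ_[p])) *
    descPochhammer ℚ_[p] j, fun k => ?_⟩
  have hs := shift_eq_sum_fwdDiff_iter h f k x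
  rw [nsmul_eq_mul] at hs
  rw [hs, eval_finsetSum]
  have e : ∀ j, k.choose j • (fwdDiff h)^[j] f x =
      eval (k : ℚ_[p]) (C ((fwdDiff h)^[j] f x / (j.factorial : ℚ_[p])) *
        descPochhammer ℚ_[p] j) := by
    intro j
    rw [eval_mul, eval_C, descPochhammer_eval_eq_descFactorial,
      Nat.descFactorial_eq_factorial_mul_choose, nsmul_eq_mul]
    have : (j.factorial : ℚ_[p]) ≠ 0 := by exact_mod_cast j.factorial_ne_zero
    push_cast
    field_simp
  rw [← Finset.sum_congr rfl fun j _ => e j]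
  rcases le_total k m with hk | hk
  · refine Finset.sum_subset (Finset.range_mono (by lia)) fun j _ hj => ?_
    rw [Nat.choose_eq_zero_of_lt (by simpa using hj), zero_smul]
  · refine (Finset.sum_subset (Finset.range_mono (by lia)) fun j _ hj => ?_).symm
    rw [Hz j (by simpa using hj), smul_zero]

open Polynomial in
lemma F_P (m : ℕ) : {h : ℚ_[p] | ∀ x : ℚ_[p], (fwdDiffOp h)^[m + 1] (F p m) x = 0} = {0} := by
  have pp : (0 : ℝ) < p := by linarith [one_lt (p := p)]
  ext h
  simp only [Set.mem_ofPred_eq, Set.mem_singleton_iff]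
  constructor
  · intro H
    by_contra hne
    have hpos : 0 < ‖h‖ := norm_pos_iff.2 hne
    obtain ⟨n, hn⟩ := pow_unbounded_of_one_lt (max ‖h‖ ‖h‖⁻¹) (one_lt (p := p))
    have h2 : ‖h‖ < (p : ℝ) ^ n := (le_max_left _ _).trans_lt hn
    have h1 : (p : ℝ) ^ (-(n : ℤ)) < ‖h‖ := by
      rw [zpow_neg, zpow_natCast]
      exact inv_lt_of_inv_lt₀ hpos ((le_max_right _ _).trans_lt hn)
    obtain ⟨Q, hQ⟩ := poly_choose h (F p m) m ((p : ℚ_[p]) ^ (-(n : ℤ))) H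
    obtain ⟨N, hN⟩ := tends n h
    have hEq : Q = C ((p : ℚ_[p]) ^ n) * (C ((p : ℚ_[p]) ^ (-(n : ℤ))) + X * C h) ^ m := by
      apply Polynomial.eq_of_infinite_eval_eq
      refine Set.Infinite.mono ?_ (Set.infinite_range_of_injective
        (f := fun t : ℕ => ((p ^ N * t : ℕ) : ℚ_[p])) ?_)
      · rintro _ ⟨t, rfl⟩
        simp only [Set.mem_ofPred_eq]
        rw [← hQ, F_in (n := n)]
        · simp only [eval_mul, eval_C, eval_pow, eval_add, eval_X]
        · unfold InB
          rw [add_sub_cancel_left]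
          exact hN t
      · intro a b hab
        have := Nat.cast_injective (R := ℚ_[p]) hab
        exact Nat.eq_of_mul_eq_mul_left (pow_pos hp.out.pos N) this
    have h3 := hQ 1
    rw [Nat.cast_one, one_mul, F_key h1 h2, hEq] at h3
    simp only [eval_mul, eval_C, eval_pow, eval_add, eval_X, one_mul] at h3
    exact val_ne h2 h3.symm
  · rintro rfl x
    rw [Function.iterate_succ_apply']
    simp [fwdDiffOp]

open Polynomial in
lemma F_notunif (m : ℕ) : ¬ (∃ r : ℝ, 0 < r ∧ ∀ x0 : ℚ_[p], ∃ a : Fin (m + 1) → ℚ_[p],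
        ∀ x : ℚ_[p], ‖x - x0‖ ≤ r → F p m x = ∑ i : Fin (m + 1), a i * x ^ (i : ℕ)) := by
  rintro ⟨r, hr, H⟩
  have pp : (0 : ℝ) < p := by linarith [one_lt (p := p)]
  obtain ⟨k, hk⟩ := pow_unbounded_of_one_lt r⁻¹ (one_lt (p := p))
  have hkr : (p : ℝ) ^ (-(k : ℤ)) < r := by
    rw [zpow_neg, zpow_natCast]
    exact inv_lt_of_inv_lt₀ hr hk
  have hnh : ‖(p : ℚ_[p]) ^ k‖ = (p : ℝ) ^ (-(k : ℤ)) := Padic.norm_p_pow k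
  have hlt : (p : ℝ) ^ (-((k + 1 : ℕ) : ℤ)) < (p : ℝ) ^ (-(k : ℤ)) :=
    zpow_lt_zpow_right₀ one_lt (by lia)
  have h1 : (p : ℝ) ^ (-((k + 1 : ℕ) : ℤ)) < ‖(p : ℚ_[p]) ^ k‖ := hnh ▸ hlt
  have h2 : ‖(p : ℚ_[p]) ^ k‖ < (p : ℝ) ^ (k + 1) := by
    rw [hnh]
    exact (rad_le k).trans_lt (one_lt_pow₀ one_lt (by lia))
  obtain ⟨a, ha⟩ := H ((p : ℚ_[p]) ^ (-((k + 1 : ℕ) : ℤ)))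
  have hEq : (∑ i : Fin (m + 1), C (a i) * X ^ (i : ℕ)) =
      C ((p : ℚ_[p]) ^ (k + 1)) * X ^ m := by
    apply Polynomial.eq_of_infinite_eval_eq
    obtain ⟨N, hN⟩ := tends (k + 1) (1 : ℚ_[p])
    refine Set.Infinite.mono ?_ (Set.infinite_range_of_injective
        (f := fun t : ℕ => (p : ℚ_[p]) ^ (-((k + 1 : ℕ) : ℤ)) + ((p ^ N * t : ℕ) : ℚ_[p])) ?_)
    · rintro _ ⟨t, rfl⟩
      have hNt := hN t
      rw [mul_one] at hNt
      have e := ha ((p : ℚ_[p]) ^ (-((k + 1 : ℕ) : ℤ)) + ((p ^ N * t : ℕ) : ℚ_[p])) (by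
        rw [add_sub_cancel_left]; linarith)
      rw [F_in (n := k + 1) (by unfold InB; rw [add_sub_cancel_left]; exact hNt)] at e
      simp only [Set.mem_ofPred_eq, eval_finsetSum, eval_mul, eval_C, eval_pow, eval_X]
      exact e.symm
    · intro a b hab
      have := Nat.cast_injective (R := ℚ_[p]) (add_left_cancel hab)
      exact Nat.eq_of_mul_eq_mul_left (pow_pos hp.out.pos N) this
  have e := ha ((p : ℚ_[p]) ^ (-((k + 1 : ℕ) : ℤ)) + (p : ℚ_[p]) ^ k) (by
    rw [add_sub_cancel_left, hnh]; exact hkr.le)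
  rw [F_key h1 h2] at e
  have e2 := congrArg
    (eval ((p : ℚ_[p]) ^ (-((k + 1 : ℕ) : ℤ)) + (p : ℚ_[p]) ^ k)) hEq
  simp only [eval_finsetSum, eval_mul, eval_C, eval_pow, eval_X] at e2
  exact val_ne h2 (e2.symm.trans e.symm)

end PadicLP


/-- There is a continuous `f : ℚ_p → ℚ_p` that is locally an ordinary polynomial of
degree `≤ m` but with `𝔓_m(f) = {0}`; in particular `f` is not uniformly locally an
ordinary polynomial. One such `f` is given by `f x = p^n x^m` for
`x ∈ p^(-n) + p^n ℤ_p` (`n ∈ ℕ`) and `f x = 0` for `x` outside `⋃ₙ (p^(-n) + p^n ℤ_p)`. -/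
theorem padic_locally_polynomial_not_uniformly
    (p : ℕ) [Fact p.Prime] (m : ℕ) :
    ∃ f : ℚ_[p] → ℚ_[p], Continuous f ∧
      (∀ x0 : ℚ_[p], ∃ r : ℝ, 0 < r ∧ ∃ a : Fin (m + 1) → ℚ_[p],
        ∀ x : ℚ_[p], ‖x - x0‖ ≤ r → f x = ∑ i : Fin (m + 1), a i * x ^ (i : ℕ)) ∧
      {h : ℚ_[p] | ∀ x : ℚ_[p], (fwdDiffOp h)^[m + 1] f x = 0} = {0} ∧
      ¬ (∃ r : ℝ, 0 < r ∧ ∀ x0 : ℚ_[p], ∃ a : Fin (m + 1) → ℚ_[p],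
        ∀ x : ℚ_[p], ‖x - x0‖ ≤ r → f x = ∑ i : Fin (m + 1), a i * x ^ (i : ℕ)) ∧
      (∀ n : ℕ, ∀ x : ℚ_[p], ‖x - (p : ℚ_[p]) ^ (-(n : ℤ))‖ ≤ (p : ℝ) ^ (-(n : ℤ)) →
        f x = (p : ℚ_[p]) ^ n * x ^ m) ∧
      (∀ x : ℚ_[p],
        (∀ n : ℕ, ¬ ‖x - (p : ℚ_[p]) ^ (-(n : ℤ))‖ ≤ (p : ℝ) ^ (-(n : ℤ))) → f x = 0) := by
  exact ⟨PadicLP.F p m, PadicLP.F_cont m, PadicLP.F_local m, PadicLP.F_P m, PadicLP.F_notunif m,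
    fun _ _ h => PadicLP.F_in h, fun _ h => PadicLP.F_out h⟩
end

section
/- Let (𝕂,|·|) be a valued field of characteristic zero with non-Archimedean absolute value, let X be an ultrametric normed space over 𝕂, let Y be a ℚ-vector space, let m ∈ ℕ and r > 0. If f : X → Y satisfies Δ_h^{m+1} f(x) = 0 for all x ∈ X and all h ∈ B_X(r), then the mixed difference Δ_{z_1 z_2 ⋯ z_{m+1}} f(x) = 0 for every x ∈ X and all z_1,…,z_{m+1} ∈ B_X(r / M), where M := max{|1/t| : t = 1,2,…,m+1} (|1/t| being the absolute value in 𝕂 of the inverse of the natural number t). -/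
/-- The mixed difference operator `Δ_{h₁ h₂ ⋯ h_s} f = Δ_{h₁}(Δ_{h₂ ⋯ h_s} f)`. -/
def mixedDiffOp {G M : Type*} [Add G] [Sub M] : List G → (G → M) → (G → M)
  | [], f => f
  | h :: t, f => fwdDiffOp h (mixedDiffOp t f)

/-- `M = max {|1/t| : t = 1, …, m+1}` computed in the valued field `𝕂`. -/
noncomputable def maxInvNorm (𝕂 : Type*) [NormedField 𝕂] (m : ℕ) : ℝ :=
  (Finset.Icc 1 (m + 1)).sup' (Finset.nonempty_Icc.mpr (Nat.le_add_left 1 m))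
    fun t => ‖((t : 𝕂))⁻¹‖

lemma mixedDiffOp_eq_sum {X Y : Type*} [AddCommGroup X] [AddCommGroup Y] (f : X → Y) :
    ∀ (n : ℕ) (z : Fin n → X) (x : X), mixedDiffOp (List.ofFn z) f x =
      ∑ e : Fin n → Bool, (∏ i, if e i then (1 : ℤ) else -1) •
        f (x + ∑ i, if e i then z i else 0) := by
  intro n
  induction n with
  | zero => intro z x; simp [mixedDiffOp]
  | succ n ih =>
    intro z x
    rw [List.ofFn_succ]
    simp only [mixedDiffOp, fwdDiffOp]
    rw [ih, ih, ← (Fin.consEquiv (fun _ : Fin (n + 1) => Bool)).sum_comp, Fintype.sum_prod_type]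
    simp [Fin.consEquiv, Fin.prod_univ_succ, Fin.sum_univ_succ, add_assoc, sub_eq_add_neg]

lemma mixedDiffOp_of_zero_mem {X Y : Type*} [AddCommGroup X] [AddCommGroup Y] (f : X → Y) :
    ∀ (l : List X), (0 : X) ∈ l → ∀ x, mixedDiffOp l f x = 0 := by
  intro l
  induction l with
  | nil => simp
  | cons a l ih =>
    intro h x
    simp only [mixedDiffOp, fwdDiffOp]
    rcases List.mem_cons.1 h with h | h
    · simp [← h]
    · simp [ih h]

lemma fwdDiffOp_iter_eq_sum {X Y : Type*} [AddCommGroup X] [AddCommGroup Y] (f : X → Y)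
    (h : X) (n : ℕ) (y : X) : (fwdDiffOp h)^[n] f y =
      ∑ k ∈ Finset.range (n + 1), ((-1 : ℤ) ^ (n - k) * n.choose k) • f (y + k • h) :=
  fwdDiff_iter_eq_sum_shift h f n y

/-- If `Δ_h^{m+1} f = 0` on `X` for all `h` in the ball `B_X(r)`, then all mixed
differences `Δ_{z₁ ⋯ z_{m+1}} f` vanish for `z₁, …, z_{m+1} ∈ B_X(r / M)`, where
`M = max {|1/t| : t = 1, …, m+1}`. -/
theorem mixedDiff_eq_zero_of_fwdDiff_eq_zero
    (𝕂 : Type*) [NormedField 𝕂] [CharZero 𝕂] [IsUltrametricDist 𝕂]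
    (X : Type*) [NormedAddCommGroup X] [NormedSpace 𝕂 X] [IsUltrametricDist X]
    (Y : Type*) [AddCommGroup Y] [Module ℚ Y]
    (m : ℕ) (r : ℝ) (hr : 0 < r) (f : X → Y)
    (hf : ∀ x h : X, ‖h‖ ≤ r → (fwdDiffOp h)^[m + 1] f x = 0) :
    ∀ x : X, ∀ z : Fin (m + 1) → X,
      (∀ i, ‖z i‖ ≤ r / maxInvNorm 𝕂 m) →
      mixedDiffOp (List.ofFn z) f x = 0 := by
  intro x z hz
  have hM : ∀ t ∈ Finset.Icc 1 (m + 1), ‖((t : 𝕂))⁻¹‖ ≤ maxInvNorm 𝕂 m := fun t ht =>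
    Finset.le_sup' (fun t : ℕ => ‖((t : 𝕂))⁻¹‖) ht
  have hM0 : 0 < maxInvNorm 𝕂 m := by
    have := hM 1 (by simp)
    simp at this
    linarith
  have key : ∑ k ∈ Finset.range (m + 1 + 1), ((-1 : ℤ) ^ (m + 1 - k) * (m + 1).choose k) •
      mixedDiffOp (List.ofFn fun i : Fin (m + 1) =>
        (1 - (k : 𝕂) * (((i : ℕ) + 1 : ℕ) : 𝕂)⁻¹) • z i) f x = 0 := by
    simp only [mixedDiffOp_eq_sum, Finset.smul_sum]
    rw [Finset.sum_comm]
    refine Finset.sum_eq_zero fun e _ => ?_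
    have h1 := hf (x + ∑ i, if e i then z i else 0)
      (-∑ i, if e i then ((((i : ℕ) + 1 : ℕ) : 𝕂)⁻¹) • z i else 0) (by
        rw [norm_neg]
        refine IsUltrametricDist.norm_sum_le_of_forall_le_of_nonneg hr.le fun i _ => ?_
        split_ifs
        · rw [norm_smul]
          calc _ ≤ maxInvNorm 𝕂 m * (r / maxInvNorm 𝕂 m) := by
                gcongr
                · exact hM _ (by simp; omega)
                · exact hz i
            _ = r := by field_simp
        · simpa using hr.le)
    rw [fwdDiffOp_iter_eq_sum] at h1
    have h2 := congrArg (fun y => (∏ i, if e i then (1 : ℤ) else -1) • y) h1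
    simp only [smul_zero, Finset.smul_sum] at h2
    rw [← h2]
    refine Finset.sum_congr rfl fun k _ => ?_
    rw [smul_comm]
    congr 3
    rw [add_assoc]
    congr 1
    rw [smul_neg, ← sub_eq_add_neg, Finset.smul_sum, ← Finset.sum_sub_distrib]
    refine Finset.sum_congr rfl fun i _ => ?_
    split_ifs
    · rw [sub_smul, one_smul, mul_smul, Nat.cast_smul_eq_nsmul]
    · simp
  rw [Finset.sum_range_succ', Finset.sum_eq_zero, zero_add] at key
  · rcases neg_one_pow_eq_or ℤ (m + 1) with h | h <;> simpa [h] using key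
  · intro k hk
    rw [mixedDiffOp_of_zero_mem, smul_zero]
    rw [List.mem_ofFn]
    refine ⟨⟨k, Finset.mem_range.1 hk⟩, ?_⟩
    have : ((k + 1 : ℕ) : 𝕂) ≠ 0 := Nat.cast_ne_zero.2 (by omega)
    simp only [mul_inv_cancel₀ this, sub_self, zero_smul]
end

section
/- Let (𝕂,|·|) be a valued field of characteristic zero with non-Archimedean absolute value, let X be an ultrametric normed space over 𝕂, let Y be a ℚ-vector space, let m ≥ 1 and r > 0, and set M := max{|1/t| : t = 1,2,…,m+1}. If f : X → Y satisfies Δ_h^{m+1} f(x) = 0 for all x ∈ X and all h ∈ B_X(r), then the map A^m(x_1,…,x_m) := (1/m!) Δ_{x_1 x_2 ⋯ x_m} f(0) is symmetric in its arguments and is m-additive on B_X(r/M), i.e. for each index k and all x_1,…,x_m, x, y ∈ B_X(r/M), A^m(x_1,…,x_{k−1}, x+y, x_{k+1},…,x_m) = A^m(x_1,…,x_{k−1}, x, x_{k+1},…,x_m) + A^m(x_1,…,x_{k−1}, y, x_{k+1},…,x_m). -/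
lemma djokovic_ring (𝕂 : Type*) [Field 𝕂] [CharZero 𝕂] {X : Type*} [AddCommGroup X] [Module 𝕂 X]
    {R : Type*} [CommRing R] (T : X → R) (h0 : T 0 = 1) (hadd : ∀ a b, T (a + b) = T a * T b)
    (s : ℕ) (h : Fin s → X) :
    ∏ i, (T (h i) - 1) = ∑ t ∈ (Finset.univ : Finset (Fin s)).powerset,
      (-1) ^ t.card * T (∑ i ∈ t, h i) *
        (T (-∑ i ∈ t, (((i : ℕ) + 1 : ℕ) : 𝕂)⁻¹ • h i) - 1) ^ s := by
  have hsum : ∀ (t : Finset (Fin s)) (g : Fin s → X), T (∑ i ∈ t, g i) = ∏ i ∈ t, T (g i) := by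
    classical
    intro t g
    induction t using Finset.induction_on with
    | empty => simp [h0]
    | insert a t ha ih => rw [Finset.sum_insert ha, Finset.prod_insert ha, hadd, ih]
  have hpow : ∀ (j : ℕ) (a : X), T a ^ j = T ((j : 𝕂) • a) := by
    intro j a
    induction j with
    | zero => simp [h0]
    | succ j ih => rw [pow_succ, ih, ← hadd]; push_cast; rw [add_smul, one_smul]
  have hexp : ∀ a : X, (T a - 1) ^ s =
      ∑ j ∈ Finset.range (s + 1), T ((j : 𝕂) • a) * ((-1) ^ (s - j) * (s.choose j : R)) := by
    intro a
    rw [sub_eq_add_neg, add_pow]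
    refine Finset.sum_congr rfl fun j _ => ?_
    rw [hpow, mul_assoc]
  simp_rw [hexp, Finset.mul_sum]
  rw [Finset.sum_comm]
  have key : ∀ j : ℕ, ∑ t ∈ (Finset.univ : Finset (Fin s)).powerset,
      (-1) ^ t.card * T (∑ i ∈ t, h i) *
        (T ((j : 𝕂) • (-∑ i ∈ t, (((i : ℕ) + 1 : ℕ) : 𝕂)⁻¹ • h i)) *
          ((-1) ^ (s - j) * (s.choose j : R)))
      = (∏ i : Fin s, (1 - T (h i + (j : 𝕂) • (-((((i : ℕ) + 1 : ℕ) : 𝕂)⁻¹ • h i))))) *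
          ((-1) ^ (s - j) * (s.choose j : R)) := by
    intro j
    simp_rw [sub_eq_add_neg (1 : R)]
    rw [Finset.prod_one_add, Finset.sum_mul]
    refine Finset.sum_congr rfl fun t _ => ?_
    rw [Finset.prod_neg, ← hsum, Finset.sum_add_distrib, ← Finset.smul_sum, Finset.sum_neg_distrib, hadd]
    ring
  simp_rw [key]
  rw [Finset.sum_range_succ']
  rw [Finset.sum_eq_zero]
  · simp only [Nat.cast_zero, zero_smul, add_zero, Nat.sub_zero, Nat.choose_zero_right,
      Nat.cast_one, mul_one, zero_add]
    have : ∀ i, T (h i) - 1 = (1 - T (h i)) * (-1) := fun i => by ring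
    simp_rw [this, Finset.prod_mul_distrib]
    simp
  · intro j hj
    rw [Finset.prod_eq_zero (Finset.mem_univ (⟨j, Finset.mem_range.mp hj⟩ : Fin s)), zero_mul]
    rw [smul_neg, smul_smul, mul_inv_cancel₀ (Nat.cast_ne_zero.mpr (Nat.succ_ne_zero j)), one_smul,
      add_neg_cancel, h0, sub_self]

/-- Translation operators as a monoid homomorphism. -/
def shiftHom (X Y : Type*) [AddCommGroup X] [AddCommGroup Y] :
    Multiplicative X →* Module.End ℤ (X → Y) where
  toFun a :=
    { toFun := fun f x => f (x + a.toAdd)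
      map_add' := fun _ _ => rfl
      map_smul' := fun _ _ => rfl }
  map_one' := by ext f x; simp
  map_mul' a b := by
    ext f x
    simp only [toAdd_mul, LinearMap.coe_mk, AddHom.coe_mk, Module.End.mul_apply]
    rw [add_assoc]

/-- The group algebra acts on functions. -/
noncomputable def shiftAct (X Y : Type*) [AddCommGroup X] [AddCommGroup Y] :
    AddMonoidAlgebra ℤ X →ₐ[ℤ] Module.End ℤ (X → Y) :=
  AddMonoidAlgebra.lift ℤ (Module.End ℤ (X → Y)) X (shiftHom X Y)

/-- The group algebra element of a translation. -/
noncomputable def shiftElt {X : Type*} [AddCommGroup X] (a : X) : AddMonoidAlgebra ℤ X :=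
  AddMonoidAlgebra.single a 1

lemma shiftElt_zero {X : Type*} [AddCommGroup X] : shiftElt (0 : X) = 1 := rfl

lemma shiftElt_add {X : Type*} [AddCommGroup X] (a b : X) :
    shiftElt (a + b) = shiftElt a * shiftElt b := by
  simp [shiftElt, AddMonoidAlgebra.single_mul_single]

lemma shiftAct_elt {X Y : Type*} [AddCommGroup X] [AddCommGroup Y] (a : X) (f : X → Y) (x : X) :
    shiftAct X Y (shiftElt a) f x = f (x + a) := by
  simp [shiftAct, shiftElt, AddMonoidAlgebra.lift_single, shiftHom]

lemma shiftAct_diff {X Y : Type*} [AddCommGroup X] [AddCommGroup Y] (a : X) (f : X → Y) :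
    shiftAct X Y (shiftElt a - 1) f = fwdDiffOp a f := by
  ext x
  rw [map_sub, map_one, LinearMap.sub_apply, Pi.sub_apply, shiftAct_elt]
  rfl

lemma shiftAct_diff_pow {X Y : Type*} [AddCommGroup X] [AddCommGroup Y] (a : X) (n : ℕ)
    (f : X → Y) : shiftAct X Y ((shiftElt a - 1) ^ n) f = (fwdDiffOp a)^[n] f := by
  induction n with
  | zero => simp
  | succ n ih =>
    rw [pow_succ', map_mul, Module.End.mul_apply, ih, shiftAct_diff, Function.iterate_succ_apply']

lemma shiftAct_mixed {X Y : Type*} [AddCommGroup X] [AddCommGroup Y] (l : List X)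
    (f : X → Y) :
    mixedDiffOp l f = shiftAct X Y ((l.map fun a => shiftElt a - 1).prod) f := by
  induction l with
  | nil => simp [mixedDiffOp]
  | cons a l ih =>
    rw [List.map_cons, List.prod_cons, map_mul, Module.End.mul_apply, ← ih, shiftAct_diff]
    rfl

lemma shiftAct_mixed_ofFn {X Y : Type*} [AddCommGroup X] [AddCommGroup Y] {n : ℕ} (z : Fin n → X)
    (f : X → Y) :
    mixedDiffOp (List.ofFn z) f = shiftAct X Y (∏ i, (shiftElt (z i) - 1)) f := by
  rw [shiftAct_mixed, List.map_ofFn, List.prod_ofFn]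
  rfl

lemma mixed_vanish (𝕂 : Type*) [NormedField 𝕂] [CharZero 𝕂]
    {X : Type*} [NormedAddCommGroup X] [NormedSpace 𝕂 X] [IsUltrametricDist X]
    {Y : Type*} [AddCommGroup Y]
    (m : ℕ) (r : ℝ) (hr : 0 < r) (f : X → Y)
    (hf : ∀ x h : X, ‖h‖ ≤ r → (fwdDiffOp h)^[m + 1] f x = 0)
    (w : Fin (m + 1) → X) (hw : ∀ i, ‖w i‖ ≤ r / maxInvNorm 𝕂 m) :
    shiftAct X Y (∏ i, (shiftElt (w i) - 1)) f = 0 := by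
  rw [djokovic_ring 𝕂 (shiftElt : X → AddMonoidAlgebra ℤ X) shiftElt_zero shiftElt_add,
    map_sum, LinearMap.sum_apply]
  refine Finset.sum_eq_zero fun t _ => ?_
  rw [map_mul, Module.End.mul_apply, shiftAct_diff_pow]
  have hz : (fwdDiffOp (-∑ i ∈ t, (((i : ℕ) + 1 : ℕ) : 𝕂)⁻¹ • w i))^[m + 1] f = 0 := by
    funext x
    refine hf x _ ?_
    rw [norm_neg]
    refine IsUltrametricDist.norm_sum_le_of_forall_le_of_nonneg hr.le fun i _ => ?_
    have hM : ∀ t ∈ Finset.Icc 1 (m + 1), ‖((t : 𝕂))⁻¹‖ ≤ maxInvNorm 𝕂 m := fun t ht =>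
      Finset.le_sup' (fun t : ℕ => ‖((t : 𝕂))⁻¹‖) ht
    have hpos : 0 < maxInvNorm 𝕂 m := by
      have := hM 1 (by simp)
      simp at this
      linarith
    rw [norm_smul]
    calc _ ≤ maxInvNorm 𝕂 m * (r / maxInvNorm 𝕂 m) :=
          mul_le_mul (hM _ (Finset.mem_Icc.mpr ⟨by omega, by omega⟩)) (hw i) (norm_nonneg _) hpos.le
      _ = r := mul_div_cancel₀ _ hpos.ne'
  rw [hz, map_zero]

/-- If `Δ_h^{m+1} f = 0` on `X` for all `h ∈ B_X(r)`, then
`A^m(x₁, …, x_m) = (1/m!) Δ_{x₁ ⋯ x_m} f(0)` is symmetric and is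
`m`-additive on the ball `B_X(r / M)`, `M = max {|1/t| : t = 1, …, m+1}`. -/
theorem multiadditivity_of_fwdDiff_eq_zero
    (𝕂 : Type*) [NormedField 𝕂] [CharZero 𝕂] [IsUltrametricDist 𝕂]
    (X : Type*) [NormedAddCommGroup X] [NormedSpace 𝕂 X] [IsUltrametricDist X]
    (Y : Type*) [AddCommGroup Y] [Module ℚ Y]
    (m : ℕ) (hm : 1 ≤ m) (r : ℝ) (hr : 0 < r) (f : X → Y)
    (hf : ∀ x h : X, ‖h‖ ≤ r → (fwdDiffOp h)^[m + 1] f x = 0) :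
    (∀ z : Fin m → X, ∀ σ : Equiv.Perm (Fin m),
      (m.factorial : ℚ)⁻¹ • mixedDiffOp (List.ofFn (z ∘ σ)) f 0 =
        (m.factorial : ℚ)⁻¹ • mixedDiffOp (List.ofFn z) f 0) ∧
    (∀ k : Fin m, ∀ z : Fin m → X, (∀ i, ‖z i‖ ≤ r / maxInvNorm 𝕂 m) →
      ∀ x y : X, ‖x‖ ≤ r / maxInvNorm 𝕂 m → ‖y‖ ≤ r / maxInvNorm 𝕂 m →
        (m.factorial : ℚ)⁻¹ • mixedDiffOp (List.ofFn (Function.update z k (x + y))) f 0 =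
          (m.factorial : ℚ)⁻¹ • mixedDiffOp (List.ofFn (Function.update z k x)) f 0 +
            (m.factorial : ℚ)⁻¹ • mixedDiffOp (List.ofFn (Function.update z k y)) f 0) := by
  constructor
  · intro z σ
    rw [shiftAct_mixed_ofFn, shiftAct_mixed_ofFn]
    have e : ∏ i, (shiftElt ((z ∘ σ) i) - 1) = ∏ i, (shiftElt (z i) - 1) :=
      Equiv.prod_comp σ fun i => shiftElt (z i) - 1
    rw [e]
  · intro k z hz x y hx hy
    rw [← smul_add]
    congr 1
    simp only [shiftAct_mixed_ofFn]
    have hu : ∀ w : X, ∏ i, (shiftElt (Function.update z k w i) - 1) =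
        (shiftElt w - 1) * ∏ i ∈ Finset.univ.erase k, (shiftElt (z i) - 1) := by
      intro w
      rw [← Finset.mul_prod_erase _ _ (Finset.mem_univ k), Function.update_self]
      congr 1
      refine Finset.prod_congr rfl fun i hi => ?_
      rw [Function.update_of_ne (Finset.ne_of_mem_erase hi)]
    have hv := mixed_vanish 𝕂 m r hr f hf (Fin.cons x (Function.update z k y)) (by
      intro i
      refine Fin.cases ?_ (fun j => ?_) i
      · simpa using hx
      · rw [Fin.cons_succ]
        by_cases hj : j = k
        · subst hj; simpa using hy
        · rw [Function.update_of_ne hj]; exact hz j)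
    rw [Fin.prod_univ_succ] at hv
    simp only [Fin.cons_zero, Fin.cons_succ] at hv
    have e : ∏ i, (shiftElt (Function.update z k (x + y) i) - 1) =
        ∏ i, (shiftElt (Function.update z k x i) - 1) +
        ∏ i, (shiftElt (Function.update z k y i) - 1) +
        (shiftElt x - 1) * ∏ i, (shiftElt (Function.update z k y i) - 1) := by
      rw [hu, hu, hu, shiftElt_add]
      ring
    rw [e, map_add, map_add, LinearMap.add_apply, LinearMap.add_apply, hv, add_zero, Pi.add_apply]
end

section
/- Let (𝕂,|·|) be a valued field of characteristic zero with non-Archimedean absolute value, let X be an ultrametric normed space over 𝕂, let Y be a ℚ-vector space, let m ≥ 1 and r > 0, and set M := max{|1/t| : t = 1,2,…,m+1}. Suppose f : X → Y satisfies Δ_h^{m+1} f(x) = 0 for all x ∈ X and all h ∈ B_X(r), and let A_m(x) := (1/m!) Δ_{x x ⋯ x} f(0) (the diagonalization of the m-additive symmetric map A^m(x_1,…,x_m) = (1/m!)Δ_{x_1⋯x_m} f(0)). Then there exists f_1 : X → Y such that Δ_h^{m} f_1(x) = 0 for all x ∈ X and all h ∈ B_X(r/M), and f(x) = f_1(x)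 + A_m(x) for all x ∈ B_X(r/M). -/
open Finset in
/-- Djokovic's identity, in purely ring-theoretic form. -/
lemma djokovic_ring_s15 {Q : Type*} [CommRing Q] (n : ℕ) (a : Fin n → Q)
    (ha : ∀ s : Finset (Fin n), ((∏ i ∈ s, a i) - 1) ^ n = 0) :
    ∏ i, (a i ^ (i.1 + 1) - 1) = 0 := by
  classical
  have h1 : ∑ k ∈ range (n + 1), ((-1) ^ k * (n.choose k : Q)) *
      ∏ i, (a i ^ (i.1 + 1) + -(a i ^ k)) = ∏ i, (a i ^ (i.1 + 1) - 1) := by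
    rw [sum_eq_single 0]
    · simp [sub_eq_add_neg]
    · intro k hk hk0
      have : ∏ i, (a i ^ (i.1 + 1) + -(a i ^ k)) = 0 := by
        have hk' : k - 1 < n := by have := mem_range.1 hk; omega
        refine prod_eq_zero (mem_univ (⟨k - 1, hk'⟩ : Fin n)) ?_
        have : k - 1 + 1 = k := by omega
        simp [this]
      rw [this, mul_zero]
    · simp
  rw [← h1]
  have h2 : ∀ k, ∏ i, (a i ^ (i.1 + 1) + -(a i ^ k)) =
      ∑ t ∈ (univ : Finset (Fin n)).powerset, ((∏ i ∈ t, a i ^ (i.1 + 1)) *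
        (-1) ^ (#(univ \ t))) * (∏ i ∈ univ \ t, a i) ^ k := by
    intro k
    rw [prod_add]
    refine sum_congr rfl fun t _ => ?_
    rw [prod_neg, prod_pow]
    ring
  simp_rw [h2, mul_sum]
  rw [sum_comm]
  refine sum_eq_zero fun t _ => ?_
  have : (-(∏ i ∈ univ \ t, a i) + 1) ^ n = 0 := by
    rw [neg_add_eq_sub, ← neg_sub, neg_pow, ha, mul_zero]
  rw [add_pow] at this
  rw [← mul_zero ((∏ i ∈ t, a i ^ (i.1 + 1)) * (-1) ^ (#(univ \ t))), ← this, mul_sum]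
  refine sum_congr rfl fun k _ => ?_
  rw [neg_pow (∏ i ∈ univ \ t, a i) k]
  ring

open Finset in
lemma sum_choose_pow {Q : Type*} [CommRing Q] (m : ℕ) (u v : Q) :
    ∑ k ∈ range (m + 1), ((-1 : ℤ) ^ (m - k) * m.choose k) • (u + k * v) ^ m
      = m.factorial * v ^ m := by
  have key : ∀ j, ∑ k ∈ range (m + 1), ((-1 : ℤ) ^ (m - k) * m.choose k) • ((k : Q) ^ j)
      = (fwdDiff (1 : Q))^[m] (fun r : Q => r ^ j) 0 := by
    intro j
    rw [fwdDiff_iter_eq_sum_shift]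
    simp
  have h2 : ∀ k : ℕ, (u + k * v) ^ m = ∑ j ∈ range (m + 1),
      (v ^ j * u ^ (m - j) * m.choose j) * (k : Q) ^ j := by
    intro k
    rw [add_comm, add_pow]
    refine sum_congr rfl fun j _ => ?_
    ring
  simp_rw [h2, smul_sum]
  rw [sum_comm]
  simp_rw [← mul_smul_comm, ← mul_sum, key]
  rw [sum_range_succ, sum_eq_zero, fwdDiff_iter_eq_factorial]
  · simp [mul_comm]
  · intro j hj
    rw [fwdDiff_iter_pow_eq_zero_of_lt (mem_range.1 hj)]
    simp

lemma pow_sub_pow_mem {Q : Type*} [CommRing Q] (I : Ideal Q) {a b : Q} (ha : a ∈ I)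
    (hb : b ∈ I) (hab : a - b ∈ I ^ 2) (m : ℕ) : a ^ m - b ^ m ∈ I ^ (m + 1) := by
  induction m with
  | zero => simp
  | succ m ih =>
    have : a ^ (m + 1) - b ^ (m + 1) = a * (a ^ m - b ^ m) + (a - b) * b ^ m := by ring
    rw [this]
    refine add_mem ?_ ?_
    · rw [pow_succ' I (m + 1)]
      exact Ideal.mul_mem_mul ha ih
    · have e : m + 1 + 1 = 2 + m := by omega
      rw [e, pow_add]
      exact Ideal.mul_mem_mul hab (Ideal.pow_mem_pow hb m)

open Finset in
/-- The core computation in a commutative ring `Q` with a character `T`. -/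
lemma core_ring {X Q : Type*} [AddCommGroup X] [CommRing Q] (T : Multiplicative X →* Q)
    (H : AddSubgroup X) (m : ℕ)
    (hT : ∀ h : Fin (m + 1) → X, (∀ i, h i ∈ H) →
      ∏ i, (T (.ofAdd (h i)) - 1) = 0) (x h : X) (hx : x ∈ H) (hh : h ∈ H) :
    (T (.ofAdd x) - 1) * (T (.ofAdd h) - 1) ^ m = 0 ∧
    ∑ k ∈ range (m + 1), ((-1 : ℤ) ^ (m - k) * m.choose k) •
      (T (.ofAdd (x + k • h)) - 1) ^ m = m.factorial * (T (.ofAdd h) - 1) ^ m := by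
  set S : Set Q := {q | ∃ y ∈ H, T (.ofAdd y) - 1 = q} with hS
  set I : Ideal Q := Ideal.span S with hI
  have hmem : ∀ y ∈ H, T (.ofAdd y) - 1 ∈ I := fun y hy =>
    Ideal.subset_span ⟨y, hy, rfl⟩
  have hI0 : I ^ (m + 1) = ⊥ := by
    rw [hI, Ideal.span, Submodule.span_pow, Submodule.span_eq_bot]
    intro q hq
    obtain ⟨g, hg, rfl⟩ := Set.mem_pow_iff_prod.1 hq
    choose y hy hyg using hg
    rw [← hT y hy]
    exact prod_congr rfl fun i _ => (hyg i).symm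
  refine ⟨?_, ?_⟩
  · have : (T (.ofAdd x) - 1) * (T (.ofAdd h) - 1) ^ m ∈ I ^ (m + 1) := by
      rw [pow_succ']
      exact Ideal.mul_mem_mul (hmem x hx) (Ideal.pow_mem_pow (hmem h hh) m)
    rwa [hI0, Ideal.mem_bot] at this
  · rw [← sum_choose_pow m (T (.ofAdd x) - 1)]
    refine sum_congr rfl fun k _ => ?_
    congr 1
    have hxk : ∀ k : ℕ, x + k • h ∈ H := fun k => add_mem hx (nsmul_mem hh k)
    have h2 : ∀ k : ℕ, (T (.ofAdd (x + k • h)) - 1) -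
        ((T (.ofAdd x) - 1) + k * (T (.ofAdd h) - 1)) ∈ I ^ 2 := by
      intro k
      induction k with
      | zero => simp
      | succ k ih =>
        have e : T (.ofAdd (x + (k + 1) • h)) = T (.ofAdd (x + k • h)) * T (.ofAdd h) := by
          rw [← map_mul, ← ofAdd_add, add_assoc, succ_nsmul]
        have e2 : (T (.ofAdd (x + (k + 1) • h)) - 1) -
            ((T (.ofAdd x) - 1) + ((k + 1 : ℕ) : Q) * (T (.ofAdd h) - 1)) =
            ((T (.ofAdd (x + k • h)) - 1) -
              ((T (.ofAdd x) - 1) + k * (T (.ofAdd h) - 1))) +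
            (T (.ofAdd (x + k • h)) - 1) * (T (.ofAdd h) - 1) := by
          rw [e]; push_cast; ring
        rw [e2]
        refine add_mem ih ?_
        rw [pow_two]
        exact Ideal.mul_mem_mul (hmem _ (hxk k)) (hmem _ hh)
    have := pow_sub_pow_mem I (hmem _ (hxk k))
      (add_mem (hmem _ hx) (Ideal.mul_mem_left I (k : Q) (hmem _ hh))) (h2 k) m
    rw [hI0, Ideal.mem_bot] at this
    exact sub_eq_zero.1 this

/-- Translation operators on functions. -/
def transHom (X Y : Type*) [AddCommGroup X] [AddCommGroup Y] :
    Multiplicative X →* Module.End ℤ (X → Y) where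
  toFun h :=
    { toFun := fun f x => f (x + h.toAdd)
      map_add' := fun _ _ => rfl
      map_smul' := fun _ _ => rfl }
  map_one' := by ext; simp
  map_mul' a b := by
    apply LinearMap.ext; intro f; funext x
    simp [Module.End.mul_apply, add_assoc]

/-- The action of the group algebra on functions. -/
noncomputable def actHom (X Y : Type*) [AddCommGroup X] [AddCommGroup Y] :
    AddMonoidAlgebra ℤ X →ₐ[ℤ] Module.End ℤ (X → Y) :=
  AddMonoidAlgebra.lift ℤ _ X (transHom X Y)

lemma actHom_of {X Y : Type*} [AddCommGroup X] [AddCommGroup Y] (h : Multiplicative X)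
    (f : X → Y) (x : X) :
    actHom X Y (AddMonoidAlgebra.of ℤ X h) f x = f (x + h.toAdd) := by
  rw [actHom, AddMonoidAlgebra.lift_of]; rfl

lemma actHom_sub {X Y : Type*} [AddCommGroup X] [AddCommGroup Y] (h : X) (f : X → Y) :
    actHom X Y (AddMonoidAlgebra.of ℤ X (.ofAdd h) - 1) f = fwdDiffOp h f := by
  funext x
  rw [map_sub, map_one, LinearMap.sub_apply, Pi.sub_apply, actHom_of]; rfl

lemma actHom_iter {X Y : Type*} [AddCommGroup X] [AddCommGroup Y] (h : X) (f : X → Y) (n : ℕ) :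
    actHom X Y ((AddMonoidAlgebra.of ℤ X (.ofAdd h) - 1) ^ n) f = (fwdDiffOp h)^[n] f := by
  induction n with
  | zero => simp
  | succ n ih =>
    rw [pow_succ', map_mul, Module.End.mul_apply, ih, actHom_sub, Function.iterate_succ_apply']

lemma mixedDiffOp_replicate {X Y : Type*} [AddCommGroup X] [AddCommGroup Y] (h : X)
    (f : X → Y) (n : ℕ) : mixedDiffOp (List.replicate n h) f = (fwdDiffOp h)^[n] f := by
  induction n with
  | zero => rfl
  | succ n ih => rw [List.replicate_succ, Function.iterate_succ_apply', ← ih]; rfl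

/-- The annihilator of `f` in the group algebra. -/
noncomputable def annIdeal {X Y : Type*} [AddCommGroup X] [AddCommGroup Y] (f : X → Y) :
    Ideal (AddMonoidAlgebra ℤ X) where
  carrier := {p | actHom X Y p f = 0}
  add_mem' {a b} ha hb := by
    have ha : actHom X Y a f = 0 := ha
    have hb : actHom X Y b f = 0 := hb
    show actHom X Y (a + b) f = 0
    rw [map_add, LinearMap.add_apply, ha, hb, add_zero]
  zero_mem' := by
    show actHom X Y 0 f = 0
    rw [map_zero, LinearMap.zero_apply]
  smul_mem' c p hp := by
    have hp : actHom X Y p f = 0 := hp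
    show actHom X Y (c * p) f = 0
    rw [map_mul, Module.End.mul_apply, hp, map_zero]

lemma mem_annIdeal {X Y : Type*} [AddCommGroup X] [AddCommGroup Y] (f : X → Y)
    (p : AddMonoidAlgebra ℤ X) : p ∈ annIdeal f ↔ actHom X Y p f = 0 := Iff.rfl

open Finset in
/-- Purely algebraic step. -/
lemma algebraic_step {X Y : Type*} [AddCommGroup X] [AddCommGroup Y] [Module ℚ Y] (m : ℕ)
    (f : X → Y) (H : AddSubgroup X) (K : AddSubgroup X)
    (hdiv : ∀ t : ℕ, t < m + 1 → ∀ h ∈ H, ∃ g ∈ K, (t + 1) • g = h)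
    (hf : ∀ x : X, ∀ h ∈ K, (fwdDiffOp h)^[m + 1] f x = 0) (x h : X) (hx : x ∈ H) (hh : h ∈ H) :
    (fwdDiffOp h)^[m] (fun y => f y - (m.factorial : ℚ)⁻¹ • (fwdDiffOp y)^[m] f 0) x = 0 := by
  set J := annIdeal f with hJ
  let T : Multiplicative X →* (AddMonoidAlgebra ℤ X ⧸ J) :=
    (Ideal.Quotient.mk J : AddMonoidAlgebra ℤ X →* _).comp (AddMonoidAlgebra.of ℤ X)
  have hTdef : ∀ y, T (.ofAdd y) = Ideal.Quotient.mk J (AddMonoidAlgebra.of ℤ X (.ofAdd y)) :=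
    fun y => rfl
  have hTK : ∀ g ∈ K, (T (.ofAdd g) - 1) ^ (m + 1) = 0 := by
    intro g hg
    rw [hTdef, ← map_one (Ideal.Quotient.mk J), ← map_sub, ← map_pow,
      Ideal.Quotient.eq_zero_iff_mem, mem_annIdeal, actHom_iter]
    funext y
    exact hf y g hg
  have hT : ∀ h : Fin (m + 1) → X, (∀ i, h i ∈ H) → ∏ i, (T (.ofAdd (h i)) - 1) = 0 := by
    intro h hh
    choose g hgK hg using fun i : Fin (m + 1) => hdiv i.1 i.2 (h i) (hh i)
    have := djokovic_ring_s15 (m + 1) (fun i => T (.ofAdd (g i))) (by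
      intro s
      rw [← map_prod, ← ofAdd_sum]
      exact hTK _ (sum_mem fun i _ => hgK i))
    rw [← this]
    refine prod_congr rfl fun i _ => ?_
    rw [← map_pow, ← ofAdd_nsmul, hg]
  obtain ⟨h1, h2⟩ := core_ring T H m hT x h hx hh
  rw [hTdef, hTdef, ← map_one (Ideal.Quotient.mk J), ← map_sub, ← map_sub, ← map_pow, ← map_mul,
    Ideal.Quotient.eq_zero_iff_mem, mem_annIdeal, map_mul, Module.End.mul_apply, actHom_iter,
    actHom_sub] at h1
  have hdiff := congrFun h1 0
  simp only [fwdDiffOp, zero_add, Pi.zero_apply] at hdiff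
  change (fwdDiffOp h)^[m] f x - (fwdDiffOp h)^[m] f 0 = 0 at hdiff
  have h3 : ∑ k ∈ range (m + 1), ((-1 : ℤ) ^ (m - k) * m.choose k) •
      (fwdDiffOp (x + k • h))^[m] f 0 = (m.factorial : ℤ) • (fwdDiffOp h)^[m] f 0 := by
    have h4 : (∑ k ∈ range (m + 1), ((-1 : ℤ) ^ (m - k) * m.choose k) •
        (AddMonoidAlgebra.of ℤ X (.ofAdd (x + k • h)) - 1) ^ m) -
        (m.factorial : ℤ) • (AddMonoidAlgebra.of ℤ X (.ofAdd h) - 1) ^ m ∈ J := by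
      rw [← Ideal.Quotient.eq_zero_iff_mem, map_sub, map_sum, sub_eq_zero]
      simp only [map_zsmul, map_pow, map_sub, map_one]
      simp only [← hTdef]
      rw [h2]
      simp
    rw [mem_annIdeal] at h4
    have h5 := congrFun h4 0
    rw [map_sub, map_sum, LinearMap.sub_apply, LinearMap.sum_apply, map_zsmul,
      LinearMap.smul_apply, actHom_iter, Pi.sub_apply, Finset.sum_apply, Pi.zero_apply,
      sub_eq_zero] at h5
    rw [Pi.smul_apply] at h5
    rw [← h5]
    refine sum_congr rfl fun k _ => ?_
    rw [map_zsmul, LinearMap.smul_apply, actHom_iter, Pi.smul_apply]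
  have h6 := fwdDiff_iter_eq_sum_shift h f m x
  have h7 := fwdDiff_iter_eq_sum_shift h
    (fun y => f y - (m.factorial : ℚ)⁻¹ • (fwdDiffOp y)^[m] f 0) m x
  change (fwdDiffOp h)^[m] _ _ = _ at h6
  change (fwdDiffOp h)^[m] _ _ = _ at h7
  rw [h7]
  simp only [smul_sub, sum_sub_distrib]
  rw [← h6]
  simp only [smul_comm _ ((m.factorial : ℚ)⁻¹)]
  rw [← smul_sum, h3, ← Int.cast_smul_eq_zsmul ℚ, smul_smul]
  have : ((m.factorial : ℚ)⁻¹ * ((m.factorial : ℤ) : ℚ)) = 1 := by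
    push_cast
    exact inv_mul_cancel₀ (by exact_mod_cast m.factorial_ne_zero)
  rw [this, one_smul]
  exact hdiff

/-- Closed balls around zero are subgroups. -/
def ballSub (X : Type*) [NormedAddCommGroup X] [IsUltrametricDist X] (r : ℝ) (hr : 0 ≤ r) :
    AddSubgroup X where
  carrier := {x | ‖x‖ ≤ r}
  add_mem' {a b} ha hb := (IsUltrametricDist.norm_add_le_max a b).trans (max_le ha hb)
  zero_mem' := by simpa using hr
  neg_mem' {a} ha := by simpa using ha

/-- If `Δ_h^{m+1} f = 0` on `X` for all `h ∈ B_X(r)` and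
`A_m(x) = (1/m!) Δ_{x x ⋯ x} f(0)` is the diagonalization of
`A^m(x₁,…,x_m) = (1/m!) Δ_{x₁ ⋯ x_m} f(0)`, then there is `f₁ : X → Y` with
`Δ_h^m f₁ = 0` for all `h ∈ B_X(r/M)` and `f = f₁ + A_m` on `B_X(r/M)`. -/
theorem step_decomposition_of_fwdDiff_eq_zero
    (𝕂 : Type*) [NormedField 𝕂] [CharZero 𝕂] [IsUltrametricDist 𝕂]
    (X : Type*) [NormedAddCommGroup X] [NormedSpace 𝕂 X] [IsUltrametricDist X]
    (Y : Type*) [AddCommGroup Y] [Module ℚ Y]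
    (m : ℕ) (hm : 1 ≤ m) (r : ℝ) (hr : 0 < r) (f : X → Y)
    (hf : ∀ x h : X, ‖h‖ ≤ r → (fwdDiffOp h)^[m + 1] f x = 0) :
    ∃ f₁ : X → Y,
      (∀ x h : X, ‖h‖ ≤ r / maxInvNorm 𝕂 m → (fwdDiffOp h)^[m] f₁ x = 0) ∧
      (∀ x : X, ‖x‖ ≤ r / maxInvNorm 𝕂 m →
        f x = f₁ x + (m.factorial : ℚ)⁻¹ • mixedDiffOp (List.replicate m x) f 0) := by
  classical
  have hM1 : 1 ≤ maxInvNorm 𝕂 m := by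
    have := Finset.le_sup' (s := Finset.Icc 1 (m + 1)) (fun t : ℕ => ‖((t : 𝕂))⁻¹‖)
      (b := 1) (by simp)
    simp only [Nat.cast_one, inv_one, norm_one] at this
    exact this
  have hM0 : 0 < maxInvNorm 𝕂 m := lt_of_lt_of_le one_pos hM1
  have hρ : 0 ≤ r / maxInvNorm 𝕂 m := (div_pos hr hM0).le
  set H := ballSub X (r / maxInvNorm 𝕂 m) hρ with hH
  have hHmem : ∀ x, x ∈ H ↔ ‖x‖ ≤ r / maxInvNorm 𝕂 m := fun x => Iff.rfl
  set F : X → Y := fun y => f y - (m.factorial : ℚ)⁻¹ • (fwdDiffOp y)^[m] f 0 with hF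
  refine ⟨fun y => if y ∈ H then F y else 0, ?_, ?_⟩
  · intro x h hh
    have hh : h ∈ H := hh
    have h7 := fwdDiff_iter_eq_sum_shift h (fun y => if y ∈ H then F y else 0) m x
    change (fwdDiffOp h)^[m] _ _ = _ at h7
    rw [h7]
    have hiff : ∀ k : ℕ, x + k • h ∈ H ↔ x ∈ H := fun k =>
      H.add_mem_cancel_right (nsmul_mem hh k)
    simp only [hiff]
    by_cases hx : x ∈ H
    · simp only [hx, if_true]
      have h8 := fwdDiff_iter_eq_sum_shift h F m x
      change (fwdDiffOp h)^[m] _ _ = _ at h8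
      rw [← h8]
      refine algebraic_step m f H (ballSub X r hr.le) ?_ (fun x h hh => hf x h hh) x h hx hh
      intro t ht g hg
      have ht0 : ((t + 1 : ℕ) : 𝕂) ≠ 0 := Nat.cast_ne_zero.2 t.succ_ne_zero
      refine ⟨((t + 1 : ℕ) : 𝕂)⁻¹ • g, ?_, ?_⟩
      · change ‖_‖ ≤ r
        rw [norm_smul]
        have hle : ‖((t + 1 : ℕ) : 𝕂)⁻¹‖ ≤ maxInvNorm 𝕂 m :=
          Finset.le_sup' (s := Finset.Icc 1 (m + 1)) (fun t : ℕ => ‖((t : 𝕂))⁻¹‖)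
            (b := t + 1) (by simp; omega)
        calc _ ≤ maxInvNorm 𝕂 m * (r / maxInvNorm 𝕂 m) :=
              mul_le_mul hle hg (norm_nonneg _) hM0.le
          _ = r := mul_div_cancel₀ _ hM0.ne'
      · rw [← Nat.cast_smul_eq_nsmul 𝕂, smul_smul, mul_inv_cancel₀ ht0, one_smul]
    · simp [hx]
  · intro x hx
    have hx : x ∈ H := hx
    rw [mixedDiffOp_replicate]
    simp [hx, hF]
end

section
/- Let (𝕂,|·|) be a valued field of characteristic zero with non-Archimedean absolute value, let X be an ultrametric normed space over 𝕂, let Y be a ℚ-vector space, let m ∈ ℕ and r > 0, and set φ(r,m) := r · (∏_{k=2}^{m+1} max{|1/t| : t = 1,…,k})^{-1}. If f : X → Y satisfies Δ_h^{m+1} f(x) = 0 for all x ∈ X and all h ∈ B_X(r), then there exist a constant A_0 ∈ Y and, for each k = 1,…,m, a symmetric k-additive map A^k : B_X(φ(r,m))^k → Y, such that f(z) = A_0 + Σ_{k=1}^m A^k(z, z, …, z) for all z ∈ B_X(φ(r,m)). -/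
/-- `φ(r, m) = r · (∏_{k=2}^{m+1} max {|1/t| : t = 1, …, k})⁻¹`, the radius on which
the polynomial decomposition is obtained. -/
noncomputable def phiRadius (𝕂 : Type*) [NormedField 𝕂] (r : ℝ) (m : ℕ) : ℝ :=
  r * ((Finset.Icc 2 (m + 1)).attach.prod fun k =>
      (Finset.Icc 1 k.1).sup'
        (Finset.nonempty_Icc.mpr (le_trans one_le_two (Finset.mem_Icc.mp k.2).1))
        fun t => ‖((t : 𝕂))⁻¹‖)⁻¹

/-- `A : (Fin k → X) → Y` is symmetric and `k`-additive on the ball `B_X(ρ)`. -/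
def IsSymmAddOn {X Y : Type*} [SeminormedAddGroup X] [AddCommGroup Y]
    (ρ : ℝ) (k : ℕ) (A : (Fin k → X) → Y) : Prop :=
  (∀ z : Fin k → X, (∀ i, ‖z i‖ ≤ ρ) → ∀ σ : Equiv.Perm (Fin k), A (z ∘ σ) = A z) ∧
  (∀ j : Fin k, ∀ z : Fin k → X, (∀ i, ‖z i‖ ≤ ρ) → ∀ x y : X, ‖x‖ ≤ ρ → ‖y‖ ≤ ρ →
    A (Function.update z j (x + y)) =
      A (Function.update z j x) + A (Function.update z j y))

open IsNilpotent in
/-- Logarithm in a nilpotent ideal. -/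
theorem exists_nil_log {R : Type*} [CommRing R] [Algebra ℚ R] (I : Ideal R) (n : ℕ)
    (hI : I ^ n = ⊥) (a : R) (ha : a ∈ I) : ∃ x ∈ I, exp x = 1 + a := by
  have nil : ∀ x ∈ I, IsNilpotent x := fun x hx => ⟨n, by
    have := Ideal.pow_mem_pow hx n
    rw [hI] at this; simpa using this⟩
  -- `exp b - 1 - b ∈ J * I` when `b ∈ J ≤ I`
  have key : ∀ k, 1 ≤ k → ∀ b ∈ I ^ k, exp b - 1 - b ∈ I ^ (k + 1) := by
    intro k hk b hb
    have hbI : b ∈ I := Ideal.pow_le_self (by omega) hb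
    have hb0 : b ^ (n + 2) = 0 := by
      have := Ideal.pow_mem_pow hbI n
      rw [hI] at this
      rw [pow_add, show b ^ n = 0 by simpa using this, zero_mul]
    rw [exp_eq_sum hb0, Finset.sum_range_succ', Finset.sum_range_succ']
    simp only [zero_add, pow_one, pow_zero, Nat.factorial_zero, Nat.factorial_one, Nat.cast_one,
      inv_one, one_smul]
    rw [add_sub_cancel_right, add_sub_cancel_right]
    refine Ideal.sum_mem _ fun i _ => ?_
    rw [Algebra.smul_def]
    refine Ideal.mul_mem_left _ _ ?_
    rw [show i + 1 + 1 = i + 2 by rfl, pow_add b, pow_two]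
    refine Ideal.mul_mem_left _ _ ?_
    rw [_root_.pow_succ]
    exact Ideal.mul_mem_mul hb hbI
  have step : ∀ k, ∃ x ∈ I, (1 + a) - exp x ∈ I ^ (k + 1) := by
    intro k
    induction k with
    | zero => exact ⟨0, I.zero_mem, by simpa using ha⟩
    | succ k ih =>
      obtain ⟨x, hx, hxk⟩ := ih
      have hu := exp_mul_exp_neg_self (nil x hx)
      set b := ((1 + a) - exp x) * exp (-x) with hb
      have hbk : b ∈ I ^ (k + 1) := Ideal.mul_mem_right _ _ hxk
      have hbI : b ∈ I := Ideal.pow_le_self (by omega) hbk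
      refine ⟨x + b, I.add_mem hx hbI, ?_⟩
      rw [exp_add_of_commute (Commute.all _ _) (nil x hx) (nil b hbI)]
      have h1 := key (k + 1) (by omega) b hbk
      have : 1 + a - exp x * exp b = -(exp x * (exp b - 1 - b)) := by
        rw [hb]; linear_combination (a + 1 - exp x) * -hu
      rw [this]
      exact (Ideal.neg_mem_iff _).2 (Ideal.mul_mem_left _ _ h1)
  obtain ⟨x, hx, h⟩ := step n
  refine ⟨x, hx, ?_⟩
  rw [_root_.pow_succ, hI] at h
  simp only [Ideal.bot_mul, Ideal.mem_bot] at h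
  exact (sub_eq_zero.1 h).symm

open IsNilpotent in
theorem nil_exp_inj {R : Type*} [CommRing R] [Algebra ℚ R] (x y : R) (hx : IsNilpotent x)
    (hy : IsNilpotent y) (h : exp x = exp y) : x = y := by
  have hd : IsNilpotent (x - y) := (Commute.all x y).isNilpotent_sub hx hy
  have h1 : exp (x - y) = 1 := by
    rw [sub_eq_add_neg, exp_add_of_commute (Commute.all _ _) hx hy.neg, h, exp_mul_exp_neg_self hy]
  set d := x - y with hdd
  obtain ⟨n, hn⟩ := hd
  have hn2 : d ^ (n + 2) = 0 := by rw [pow_add, hn, zero_mul]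
  rw [exp_eq_sum hn2, Finset.sum_range_succ', Finset.sum_range_succ'] at h1
  simp only [zero_add, pow_one, pow_zero, Nat.factorial_zero, Nat.factorial_one, Nat.cast_one,
      inv_one, one_smul, add_eq_right] at h1
  have h2 : d * (∑ i ∈ Finset.range n, ((i + 1 + 1).factorial : ℚ)⁻¹ • d ^ i * d + 1) = 0 := by
    rw [mul_add, mul_one, Finset.mul_sum, ← h1]
    congr 1
    refine Finset.sum_congr rfl fun i _ => ?_
    rw [smul_mul_assoc, mul_smul_comm]; ring_nf
  have h3 : IsUnit (∑ i ∈ Finset.range n, ((i + 1 + 1).factorial : ℚ)⁻¹ • d ^ i * d + 1) := by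
    refine IsNilpotent.isUnit_add_one ?_
    rw [← Finset.sum_mul]
    exact (Commute.all _ _).isNilpotent_mul_left ⟨n, hn⟩
  have := (h3.mul_left_eq_zero).1 h2
  exact sub_eq_zero.1 this

/-- Djoković's identity. -/
theorem djokovic_identity {𝕂 X R : Type*} [Field 𝕂] [CharZero 𝕂] [AddCommGroup X] [Module 𝕂 X]
    [CommRing R] (T : X → R) (T0 : T 0 = 1) (Tadd : ∀ x y, T (x + y) = T x * T y)
    (n : ℕ) (h : Fin n → X) :
    ∏ j, (T (h j) - 1) = ∑ S ∈ (Finset.univ : Finset (Fin n)).powerset,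
      (-1) ^ S.card * T (∑ j ∈ S, h j) * (T (-∑ j ∈ S, ((j.1 + 1 : ℕ) : 𝕂)⁻¹ • h j) - 1) ^ n := by
  have Tsum : ∀ (S : Finset (Fin n)) (g : Fin n → X), T (∑ j ∈ S, g j) = ∏ j ∈ S, T (g j) := by
    intro S g
    induction S using Finset.cons_induction with
    | empty => simp [T0]
    | cons a s ha ih => rw [Finset.sum_cons, Finset.prod_cons, Tadd, ih]
  have Tpow : ∀ (k : ℕ) (x : X), T x ^ k = T (k • x) := by
    intro k x
    induction k with
    | zero => simp [T0]
    | succ k ih => rw [pow_succ, ih, succ_nsmul, Tadd]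
  have e1 : ∀ S : Finset (Fin n), (-1) ^ S.card * T (∑ j ∈ S, h j) *
      (T (-∑ j ∈ S, ((j.1 + 1 : ℕ) : 𝕂)⁻¹ • h j) - 1) ^ n =
      ∑ k ∈ Finset.range (n + 1), (∏ j ∈ S, -T ((1 - (k : 𝕂) * ((j.1 + 1 : ℕ) : 𝕂)⁻¹) • h j)) *
        ((-1) ^ (n - k) * (n.choose k : R)) := by
    intro S
    rw [sub_eq_add_neg, add_pow, Finset.mul_sum]
    refine Finset.sum_congr rfl fun k _ => ?_
    rw [Finset.prod_neg, ← Tsum, Tpow]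
    have : T (∑ j ∈ S, (1 - (k : 𝕂) * ((j.1 + 1 : ℕ) : 𝕂)⁻¹) • h j) =
        T (∑ j ∈ S, h j) * T (k • -∑ j ∈ S, ((j.1 + 1 : ℕ) : 𝕂)⁻¹ • h j) := by
      rw [← Tadd]
      congr 1
      simp only [sub_smul, one_smul, Finset.sum_sub_distrib, mul_smul, ← Finset.smul_sum,
        Nat.cast_smul_eq_nsmul, smul_neg, ← sub_eq_add_neg]
    rw [this]; ring
  rw [Finset.sum_congr rfl fun S _ => e1 S, Finset.sum_comm]
  simp_rw [← Finset.sum_mul, ← Finset.prod_add_one]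
  rw [Finset.sum_eq_single 0]
  · have : ∀ j : Fin n, -T (h j) + 1 = -(T (h j) - 1) := fun j => by ring
    simp only [Nat.cast_zero, zero_mul, sub_zero, one_smul, Nat.choose_zero_right, Nat.cast_one,
      mul_one, this, Finset.prod_neg, Finset.card_univ, Fintype.card_fin]
    rw [mul_right_comm, ← pow_add, Nat.sub_zero, Even.neg_one_pow ⟨n, rfl⟩, one_mul]
  · intro k hk hk0
    rw [Finset.mem_range] at hk
    have : ∏ j : Fin n, (-T ((1 - (k : 𝕂) * ((j.1 + 1 : ℕ) : 𝕂)⁻¹) • h j) + 1) = 0 := by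
      refine Finset.prod_eq_zero (i := ⟨k - 1, by omega⟩) (Finset.mem_univ _) ?_
      have : k - 1 + 1 = k := by omega
      simp only [this]
      rw [mul_inv_cancel₀ (by exact_mod_cast hk0)]
      simp [T0]
    rw [this, zero_mul]
  · simp

theorem phiRadius_mul_le (𝕂 : Type*) [NormedField 𝕂] (r : ℝ) (hr : 0 < r) (m j : ℕ)
    (h1 : 1 ≤ j) (h2 : j ≤ m + 1) : ‖((j : 𝕂))⁻¹‖ * phiRadius 𝕂 r m ≤ r := by
  unfold phiRadius
  set M : {x // x ∈ Finset.Icc 2 (m + 1)} → ℝ := fun k => (Finset.Icc 1 k.1).sup'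
        (Finset.nonempty_Icc.mpr (le_trans one_le_two (Finset.mem_Icc.mp k.2).1))
        fun t => ‖((t : 𝕂))⁻¹‖ with hM
  have hle : ∀ k, ∀ t : ℕ, 1 ≤ t → t ≤ k.1 → ‖((t : 𝕂))⁻¹‖ ≤ M k := fun k t h h' =>
    Finset.le_sup' (fun t : ℕ => ‖((t : 𝕂))⁻¹‖) (Finset.mem_Icc.2 ⟨h, h'⟩)
  have hM1 : ∀ k, 1 ≤ M k := fun k => by
    have := hle k 1 le_rfl (le_trans one_le_two (Finset.mem_Icc.mp k.2).1)
    simpa using this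
  set P := (Finset.Icc 2 (m + 1)).attach.prod M
  have hP1 : 1 ≤ P := Finset.one_le_prod fun i _ => hM1 i
  have hj : ‖((j : 𝕂))⁻¹‖ ≤ P := by
    rcases h1.eq_or_lt with rfl | h
    · simpa using hP1
    · let k : {x // x ∈ Finset.Icc 2 (m + 1)} := ⟨j, Finset.mem_Icc.2 ⟨h, h2⟩⟩
      refine (hle k j h1 le_rfl).trans ?_
      have hk : M k * ∏ i ∈ (Finset.Icc 2 (m + 1)).attach.erase k, M i = P :=
        Finset.mul_prod_erase _ M (Finset.mem_attach _ k)
      rw [← hk]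
      exact le_mul_of_one_le_right (zero_le_one.trans (hM1 k))
        (Finset.one_le_prod fun i _ => hM1 i)
  have hP : 0 < P := by linarith
  rw [← mul_assoc, ← div_eq_mul_inv, div_le_iff₀ hP]
  nlinarith

open AddMonoidAlgebra in
/-- The universal (group algebra) model of the translates of `f`. -/
theorem exists_translation_ring.{u, v} {X : Type u} {Y : Type v} [AddCommGroup X] [AddCommGroup Y]
    [Module ℚ Y] (f : X → Y) (n : ℕ) (P : X → Prop)
    (hf : ∀ x h : X, P h → (fwdDiffOp h)^[n] f x = 0) :
    ∃ (R : Type u) (_ : CommRing R) (_ : Algebra ℚ R) (T : X → R) (L : R →+ Y),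
      T 0 = 1 ∧ (∀ x y, T (x + y) = T x * T y) ∧ (∀ x, L (T x) = f x) ∧
      ∀ h, P h → (T h - 1) ^ n = 0 := by
  let S := AddMonoidAlgebra ℚ X
  let L : S →ₗ[ℚ] Y := (Finsupp.linearCombination ℚ f).comp
    (coeffLinearEquiv (S := ℚ) (M := X) ℚ).toLinearMap
  let t : X → S := fun x => single x 1
  have Lt : ∀ x, L (t x) = f x := by
    intro x
    change Finsupp.linearCombination ℚ f (Finsupp.single x 1) = f x
    simp
  have t0 : t 0 = 1 := rfl
  have tadd : ∀ x y, t (x + y) = t x * t y := by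
    intro x y
    simp only [t]
    rw [single_mul_single, one_mul]
  let J : Ideal S :=
    { carrier := {a | ∀ b, L (a * b) = 0}
      add_mem' := by
        intro a a' h h' b
        rw [add_mul, map_add, h, h', add_zero]
      zero_mem' := by intro b; simp
      smul_mem' := by
        intro c a h b
        rw [smul_eq_mul, mul_comm c a, mul_assoc]; exact h _ }
  have hdiff : ∀ k x h, L (t x * (t h - 1) ^ k) = (fwdDiffOp h)^[k] f x := by
    intro k
    induction k with
    | zero => intro x h; simp [Lt]
    | succ k ih =>
      intro x h
      rw [Function.iterate_succ_apply', fwdDiffOp, ← ih, ← ih, ← map_sub, tadd]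
      congr 1; ring
  have hJ : ∀ h, P h → (t h - 1) ^ n ∈ J := by
    intro h hP b
    have : ∀ b : S, L ((t h - 1) ^ n * b) = 0 := by
      intro b
      induction b using AddMonoidAlgebra.induction_linear with
      | zero => simp
      | add a b ha hb => rw [mul_add, map_add, ha, hb, add_zero]
      | single x q =>
        have : (single x q : S) = q • t x := by
          simp only [t]; rw [smul_single, smul_eq_mul, mul_one]
        rw [this, mul_smul_comm, map_smul, mul_comm, hdiff, hf x h hP, smul_zero]
    exact this b
  refine ⟨S ⧸ J, inferInstance, inferInstance, fun x => Ideal.Quotient.mk J (t x),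
    QuotientAddGroup.lift J.toAddSubgroup L.toAddMonoidHom ?_, ?_, ?_, ?_, ?_⟩
  · intro a ha
    have := (show ∀ b, L (a * b) = 0 from ha) 1
    simpa using this
  · change Ideal.Quotient.mk J (t 0) = 1
    rw [t0, map_one]
  · intro x y
    change Ideal.Quotient.mk J (t (x + y)) = Ideal.Quotient.mk J (t x) * Ideal.Quotient.mk J (t y)
    rw [tadd, map_mul]
  · intro x; exact Lt x
  · intro h hP
    rw [← map_one (Ideal.Quotient.mk J), ← map_sub, ← map_pow, Ideal.Quotient.eq_zero_iff_mem]
    exact hJ h hP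

/-- Local Fréchet-type decomposition: if `Δ_h^{m+1} f = 0` on `X` for all `h ∈ B_X(r)`,
then on `B_X(φ(r,m))` the function `f` is a sum of a constant and the diagonalizations
of symmetric `k`-additive maps, `k = 1, …, m`. -/
theorem local_polynomial_decomposition_of_fwdDiff_eq_zero
    (𝕂 : Type*) [NormedField 𝕂] [CharZero 𝕂] [IsUltrametricDist 𝕂]
    (X : Type*) [NormedAddCommGroup X] [NormedSpace 𝕂 X] [IsUltrametricDist X]
    (Y : Type*) [AddCommGroup Y] [Module ℚ Y]
    (m : ℕ) (r : ℝ) (hr : 0 < r) (f : X → Y)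
    (hf : ∀ x h : X, ‖h‖ ≤ r → (fwdDiffOp h)^[m + 1] f x = 0) :
    ∃ A₀ : Y, ∃ A : (k : ℕ) → (Fin k → X) → Y,
      (∀ k : ℕ, 1 ≤ k → k ≤ m → IsSymmAddOn (phiRadius 𝕂 r m) k (A k)) ∧
      ∀ z : X, ‖z‖ ≤ phiRadius 𝕂 r m →
        f z = A₀ + ∑ k ∈ Finset.Icc 1 m, A k (fun _ => z) := by
  classical
  obtain ⟨R, _, _, T, L, T0, Tadd, LT, Tnil⟩ :=
    exists_translation_ring f (m + 1) (fun h => ‖h‖ ≤ r) hf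
  set ρ := phiRadius 𝕂 r m with hρ
  -- products of `m + 1` differences with steps in the small ball vanish
  have hprod : ∀ h : Fin (m + 1) → X, (∀ i, ‖h i‖ ≤ ρ) → ∏ j, (T (h j) - 1) = 0 := by
    intro h hh
    rw [djokovic_identity (𝕂 := 𝕂) T T0 Tadd]
    refine Finset.sum_eq_zero fun S _ => ?_
    rw [Tnil, mul_zero]
    rw [norm_neg]
    refine IsUltrametricDist.norm_sum_le_of_forall_le_of_nonneg hr.le fun j _ => ?_
    rw [norm_smul]
    exact (mul_le_mul_of_nonneg_left (hh j) (norm_nonneg _)).trans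
      (phiRadius_mul_le 𝕂 r hr m (j.1 + 1) (by omega) (by omega))
  let s : Set R := {a | ∃ x : X, ‖x‖ ≤ ρ ∧ a = T x - 1}
  let I : Ideal R := Ideal.span s
  have hI : I ^ (m + 1) = ⊥ := by
    change Submodule.span R s ^ (m + 1) = ⊥
    rw [Submodule.span_pow, Submodule.span_eq_bot]
    intro a ha
    obtain ⟨g, rfl⟩ := Set.mem_pow.1 ha
    choose x hx hgx using fun i => (g i).2
    rw [List.prod_ofFn, ← hprod x hx]
    exact Finset.prod_congr rfl fun i _ => hgx i
  have hpow : ∀ a ∈ I, a ^ (m + 1) = 0 := by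
    intro a ha
    have := Ideal.pow_mem_pow ha (m + 1)
    rw [hI] at this; simpa using this
  have hlog : ∀ x : X, ∃ l ∈ I, ‖x‖ ≤ ρ → IsNilpotent.exp l = T x := by
    intro x
    by_cases hx : ‖x‖ ≤ ρ
    · obtain ⟨l, hl, e⟩ := exists_nil_log I (m + 1) hI (T x - 1) (Ideal.subset_span ⟨x, hx, rfl⟩)
      exact ⟨l, hl, fun _ => by rw [e]; ring⟩
    · exact ⟨0, I.zero_mem, fun h => absurd h hx⟩
  choose l hlI hl using hlog
  have ladd : ∀ x y : X, ‖x‖ ≤ ρ → ‖y‖ ≤ ρ → l (x + y) = l x + l y := by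
    intro x y hx hy
    have nil : ∀ x, IsNilpotent (l x) := fun x => ⟨m + 1, hpow _ (hlI x)⟩
    refine nil_exp_inj _ _ (nil _) ⟨m + 1, hpow _ (I.add_mem (hlI x) (hlI y))⟩ ?_
    rw [IsNilpotent.exp_add_of_commute (Commute.all _ _) (nil x) (nil y), hl x hx, hl y hy,
      hl _ ((IsUltrametricDist.norm_add_le_max x y).trans (max_le hx hy)), Tadd]
  refine ⟨L 1, fun k z => (k.factorial : ℚ)⁻¹ • L (∏ i, l (z i)), ?_, ?_⟩
  · intro k _ _
    refine ⟨?_, ?_⟩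
    · intro z _ σ
      have : ∏ i, l ((z ∘ σ) i) = ∏ i, l (z i) := Equiv.prod_comp σ fun i => l (z i)
      simp only [this]
    · intro j z _ x y hx hy
      have e : ∀ w : X, ∏ i, l (Function.update z j w i) =
          l w * ∏ i ∈ Finset.univ.erase j, l (z i) := by
        intro w
        rw [← Finset.mul_prod_erase _ _ (Finset.mem_univ j), Function.update_self]
        congr 1
        refine Finset.prod_congr rfl fun i hi => ?_
        rw [Function.update_of_ne (Finset.ne_of_mem_erase hi)]
      simp only [e]
      rw [ladd x y hx hy, add_mul, map_add, smul_add]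
  · intro z hz
    rw [← LT z, ← hl z hz, IsNilpotent.exp_eq_sum (hpow _ (hlI z)), Finset.sum_range_succ',
      map_add, map_sum, add_comm]
    congr 1
    · simp
    · rw [Finset.range_eq_Ico, Finset.sum_Ico_add' (fun i => L ((i.factorial : ℚ)⁻¹ • l z ^ i)) 0 m 1]
      refine Finset.sum_congr (by ext; simp only [Finset.mem_Ico, Finset.mem_Icc]; omega) fun i _ => ?_
      rw [map_rat_smul]
      simp
end

section
/- (Characterization of uniformly locally polynomial functions) Let (𝕂,|·|) be a valued field of characteristic zero with non-Archimedean absolute value, let X be an ultrametric normed space over 𝕂, let Y be a ℚ-vector space, let m ∈ ℕ and r > 0, and set φ(r,m) := r · (∏_{k=2}^{m+1} max{|1/t| : t = 1,…,k})^{-1}. If f : X → Y satisfies Δ_h^{m+1} f(x) = 0 for all x ∈ X and all h ∈ B_X(r), then for every x_0 ∈ X there exist a constant A_{0,x_0} ∈ Y and, for each k = 1,…,m, a symmetric k-additive map A^{k,x_0} : B_X(φ(r,m))^k → Y, such that f(x_0 + z) = A_{0,x_0} + Σ_{k=1}^m A^{k,x_0}(z, z, …, z) for all z ∈ B_X(φ(r,m)).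 -/
namespace ULP

open Finset

/-- Translation operators on functions. -/
noncomputable def shiftHom (G Y : Type*) [AddCommGroup G] [AddCommGroup Y] :
    Multiplicative G →* Module.End ℤ (G → Y) where
  toFun a := LinearMap.funLeft ℤ Y (fun x => x + a.toAdd)
  map_one' := by
    ext f x
    simp [LinearMap.funLeft_apply]
  map_mul' a b := by
    ext f x
    simp only [LinearMap.funLeft_apply, Module.End.mul_apply, toAdd_mul]
    congr 1
    abel

/-- The action of the group algebra on functions. -/
noncomputable def act (G Y : Type*) [AddCommGroup G] [AddCommGroup Y] :
    AddMonoidAlgebra ℤ G →ₐ[ℤ] Module.End ℤ (G → Y) :=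
  AddMonoidAlgebra.lift ℤ (Module.End ℤ (G → Y)) G (shiftHom G Y)

/-- The group element `a` in the group algebra. -/
noncomputable def tr {G : Type*} [AddCommGroup G] (a : G) : AddMonoidAlgebra ℤ G :=
  AddMonoidAlgebra.single a 1

section basics
variable {G Y : Type*} [AddCommGroup G] [AddCommGroup Y]

lemma tr_zero : tr (0 : G) = 1 := rfl

lemma tr_add (a b : G) : tr (a + b) = tr a * tr b := by
  simp [tr, AddMonoidAlgebra.single_mul_single]

lemma act_tr (a : G) (f : G → Y) (x : G) : act G Y (tr a) f x = f (x + a) := by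
  simp [act, tr, shiftHom, LinearMap.funLeft_apply]

lemma act_d (a : G) (f : G → Y) (x : G) : act G Y (tr a - 1) f x = f (x + a) - f x := by
  rw [map_sub, LinearMap.sub_apply, Pi.sub_apply, act_tr, map_one]
  rfl

lemma act_mul (p q : AddMonoidAlgebra ℤ G) (f : G → Y) :
    act G Y (p * q) f = act G Y p (act G Y q f) := by
  rw [map_mul]; rfl

lemma iter_eq (a : G) (f : G → Y) (n : ℕ) :
    (fwdDiffOp a)^[n] f = act G Y ((tr a - 1) ^ n) f := by
  induction n with
  | zero => simp
  | succ n ih =>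
    rw [Function.iterate_succ_apply', ih, pow_succ', act_mul]
    funext x
    rw [act_d]
    rfl

/-- mixed difference product -/
noncomputable def dp {n : ℕ} (h : Fin n → G) : AddMonoidAlgebra ℤ G := ∏ i, (tr (h i) - 1)

lemma dp_succ {n : ℕ} (h : Fin (n + 1) → G) :
    dp h = dp (Fin.tail h) * (tr (h 0) - 1) := by
  rw [dp, Fin.prod_univ_succ, mul_comm]; rfl

end basics

section djok

lemma tr_sum {G ι : Type*} [AddCommGroup G] (s : Finset ι) (u : ι → G) :
    tr (∑ i ∈ s, u i) = ∏ i ∈ s, tr (u i) := by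
  classical
  induction s using Finset.induction_on with
  | empty => simp [tr_zero]
  | insert a s ha ih => rw [sum_insert ha, prod_insert ha, tr_add, ih]

lemma tr_nsmul {G : Type*} [AddCommGroup G] (n : ℕ) (u : G) :
    tr (n • u) = tr u ^ n := by
  induction n with
  | zero => simp [tr_zero]
  | succ n ih => rw [succ_nsmul, tr_add, ih, pow_succ]

lemma djok (𝕂 : Type*) [Field 𝕂] [CharZero 𝕂] {X : Type*} [AddCommGroup X] [Module 𝕂 X]
    {n : ℕ} (h : Fin n → X) :
    dp h = ∑ S ∈ (univ : Finset (Fin n)).powerset, (-1) ^ S.card *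
      (tr (∑ j ∈ S, h j) *
        (tr (∑ j ∈ S, -(((j : ℕ) + 1 : ℕ) : 𝕂)⁻¹ • h j) - 1) ^ n) := by
  have key : ∀ i : ℕ, ∑ S ∈ (univ : Finset (Fin n)).powerset, (-1) ^ S.card *
      (tr (∑ j ∈ S, h j) * tr (∑ j ∈ S, -(((j : ℕ) + 1 : ℕ) : 𝕂)⁻¹ • h j) ^ i) =
      ∏ j, (- tr (h j + i • (-(((j : ℕ) + 1 : ℕ) : 𝕂)⁻¹ • h j)) + 1) := by
    intro i
    rw [prod_add]
    refine sum_congr rfl fun S _ => ?_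
    rw [prod_const_one, mul_one, prod_neg, ← tr_nsmul, ← tr_add, ← tr_sum, smul_sum,
      sum_add_distrib]
  have e : ∀ x : AddMonoidAlgebra ℤ X, (x - 1) ^ n =
      ∑ i ∈ range (n + 1), x ^ i * ((-1) ^ (n - i) * (n.choose i : AddMonoidAlgebra ℤ X)) := by
    intro x
    rw [sub_eq_add_neg, add_pow]
    exact sum_congr rfl fun _ _ => by ring
  simp_rw [e, mul_sum]
  rw [sum_comm]
  have e2 : ∀ i ∈ range (n + 1), (∑ S ∈ (univ : Finset (Fin n)).powerset, (-1) ^ S.card *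
      (tr (∑ j ∈ S, h j) * (tr (∑ j ∈ S, -(((j : ℕ) + 1 : ℕ) : 𝕂)⁻¹ • h j) ^ i *
        ((-1) ^ (n - i) * (n.choose i : AddMonoidAlgebra ℤ X))))) =
      (∏ j, (- tr (h j + i • (-(((j : ℕ) + 1 : ℕ) : 𝕂)⁻¹ • h j)) + 1)) *
        ((-1) ^ (n - i) * (n.choose i : AddMonoidAlgebra ℤ X)) := by
    intro i _
    rw [← key, sum_mul]
    exact sum_congr rfl fun _ _ => by ring
  rw [sum_congr rfl e2, sum_eq_single 0]
  · simp only [zero_smul, add_zero, Nat.sub_zero, Nat.choose_zero_right, Nat.cast_one, mul_one]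
    have : ((-1 : AddMonoidAlgebra ℤ X)) ^ n = ∏ _j : Fin n, (-1) := by simp
    rw [this, ← prod_mul_distrib, dp]
    exact prod_congr rfl fun _ _ => by ring
  · intro i hi hi0
    have hi' := mem_range.1 hi
    have : ∏ j, (- tr (h j + i • (-(((j : ℕ) + 1 : ℕ) : 𝕂)⁻¹ • h j)) + 1) = 0 := by
      refine prod_eq_zero (mem_univ (⟨i - 1, by omega⟩ : Fin n)) ?_
      have h1 : i - 1 + 1 = i := by omega
      simp only [h1]
      rw [← Nat.cast_smul_eq_nsmul 𝕂, smul_smul, mul_neg, mul_inv_cancel₀ (by exact_mod_cast hi0),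
        neg_smul, one_smul, add_neg_cancel, tr_zero]
      simp
    rw [this, zero_mul]
  · simp

end djok

section polar
variable {G Y : Type*} [AddCommGroup G] [AddCommGroup Y]

lemma lower {k : ℕ} (A : MultilinearMap ℤ (fun _ : Fin k => G) Y) (n : ℕ) :
    ∀ (S : Finset (Fin k)) (c : Fin k → G) (h : Fin n → G), S.card < n →
      act G Y (dp h) (fun x => A (S.piecewise (fun _ => x) c)) = 0 := by
  induction n with
  | zero => intro S c h hn; omega
  | succ n ih =>
    intro S c h hn
    rw [dp_succ, act_mul]
    have : act G Y (tr (h 0) - 1) (fun x => A (S.piecewise (fun _ => x) c)) =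
        ∑ T ∈ S.powerset.erase S, fun x => A (T.piecewise (fun _ => x)
          (S.piecewise (fun _ => h 0) c)) := by
      funext x
      rw [act_d, Finset.sum_apply, sub_eq_iff_eq_add]
      have e := A.map_piecewise_add (fun _ => x) (S.piecewise (fun _ => h 0) c) S
      rw [← sum_erase_add _ _ (mem_powerset_self S)] at e
      have e1 : S.piecewise ((fun _ => x) + S.piecewise (fun _ => h 0) c)
          (S.piecewise (fun _ => h 0) c) = S.piecewise (fun _ => x + h 0) c := by
        funext i
        by_cases hi : i ∈ S <;> simp [hi]
      have e2 : S.piecewise (fun _ => x) (S.piecewise (fun _ => h 0) c) =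
          S.piecewise (fun _ => x) c := by
        funext i
        by_cases hi : i ∈ S <;> simp [hi]
      rw [e1, e2] at e
      exact e
    rw [this, map_sum]
    refine sum_eq_zero fun T hT => ih _ _ _ ?_
    rw [mem_erase, mem_powerset] at hT
    have := card_lt_card (lt_of_le_of_ne hT.2 hT.1)
    omega

lemma polar (n : ℕ) : ∀ (A : MultilinearMap ℤ (fun _ : Fin n => G) Y)
    (_ : ∀ z (σ : Equiv.Perm (Fin n)), A (z ∘ σ) = A z) (h : Fin n → G),
    act G Y (dp h) (fun x => A (fun _ => x)) = fun _ => n.factorial • A h := by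
  induction n with
  | zero =>
    intro A _ h
    funext x
    simp only [dp, univ_eq_empty, prod_empty, map_one, Module.End.one_apply,
      Nat.factorial_zero, one_smul]
    congr 1
    exact Subsingleton.elim _ _
  | succ n ih =>
    intro A hA h
    rw [dp_succ, act_mul]
    have : act G Y (tr (h 0) - 1) (fun x => A (fun _ => x)) =
        ∑ T ∈ (univ : Finset (Fin (n + 1))).powerset.erase univ,
          fun x => A (T.piecewise (fun _ => x) (fun _ => h 0)) := by
      funext x
      rw [act_d, Finset.sum_apply, sub_eq_iff_eq_add]
      have e := A.map_piecewise_add (fun _ => x) (fun _ => h 0) univ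
      rw [← sum_erase_add _ _ (mem_powerset_self univ)] at e
      simpa [Pi.add_def] using e
    rw [this, map_sum]
    have hcur : ∀ z (σ : Equiv.Perm (Fin n)),
        A.curryLeft (h 0) (z ∘ σ) = A.curryLeft (h 0) z := by
      intro z σ
      simp only [MultilinearMap.curryLeft_apply]
      rw [← hA (Fin.cons (h 0) z) (Equiv.Perm.decomposeFin.symm (0, σ))]
      congr 1
      funext i
      refine Fin.cases ?_ (fun j => ?_) i
      · simp
      · simp
    have e : ∀ T ∈ (univ : Finset (Fin (n + 1))).powerset.erase univ,
        act G Y (dp (Fin.tail h)) (fun x => A (T.piecewise (fun _ => x) (fun _ => h 0))) =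
        if T.card = n then (fun _ : G => n.factorial • A h) else (0 : G → Y) := by
      intro T hT
      have hT' : T.card < n + 1 := by
        have := card_lt_card (lt_of_le_of_ne (subset_univ T) (mem_erase.1 hT).1)
        simpa using this
      split_ifs with hc
      · have h1 : Tᶜ.card = 1 := by rw [card_compl, hc]; simp
        obtain ⟨i, hi⟩ := card_eq_one.1 h1
        have hmem : ∀ j, j ∈ T ↔ j ≠ i := by
          intro j
          have : j ∈ Tᶜ ↔ j = i := by rw [hi, mem_singleton]
          rw [mem_compl] at this
          tauto
        have : (fun x => A (T.piecewise (fun _ => x) (fun _ => h 0))) =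
            fun x => A.curryLeft (h 0) (fun _ => x) := by
          funext x
          rw [MultilinearMap.curryLeft_apply, ← hA _ (Equiv.swap 0 i)]
          congr 1
          funext j
          simp only [Function.comp_apply, Finset.piecewise, hmem]
          refine Fin.cases ?_ (fun j => ?_) j
          · simp
          · rw [if_pos]
            · simp
            · intro hh
              rw [Equiv.swap_apply_eq_iff] at hh
              simp at hh
        rw [this, ih _ hcur, MultilinearMap.curryLeft_apply]
        simp
      · exact lower A n T _ _ (by omega)
    rw [sum_congr rfl e, ← sum_filter]
    have e3 : ((univ : Finset (Fin (n + 1))).powerset.erase univ).filter (fun T => T.card = n)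
        = powersetCard n univ := by
      ext T
      simp only [mem_filter, mem_erase, mem_powerset, mem_powersetCard]
      constructor
      · rintro ⟨⟨_, h1⟩, h2⟩; exact ⟨h1, h2⟩
      · rintro ⟨h1, h2⟩
        refine ⟨⟨?_, h1⟩, h2⟩
        rintro rfl
        simp at h2
    rw [e3, sum_const, card_powersetCard]
    funext x
    simp only [card_univ, Fintype.card_fin, Nat.choose_succ_self_right, Pi.smul_apply,
      Nat.factorial_succ, mul_smul]

end polar

section decomp
variable {G Y : Type*} [AddCommGroup G] [AddCommGroup Y] [Module ℚ Y]

lemma dp_update {n : ℕ} (z : Fin n → G) (j : Fin n) (a : G) :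
    dp (Function.update z j a) = (tr a - 1) * ∏ i ∈ univ \ {j}, (tr (z i) - 1) := by
  rw [← prod_update_of_mem (mem_univ j) (fun i => tr (z i) - 1), dp]
  refine prod_congr rfl fun i _ => ?_
  by_cases hi : i = j
  · subst hi; simp
  · simp [hi]

/-- The top-degree part. -/
lemma exists_top (n : ℕ) (g : G → Y)
    (hg : ∀ h : Fin (n + 1) → G, act G Y (dp h) g = 0) :
    ∃ A : MultilinearMap ℤ (fun _ : Fin n => G) Y,
      ∀ h, A h = ((n.factorial : ℚ)⁻¹) • act G Y (dp h) g 0 := by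
  have hadd : ∀ (z : Fin n → G) (j : Fin n) (a b : G),
      ((n.factorial : ℚ)⁻¹) • act G Y (dp (Function.update z j (a + b))) g 0 =
      ((n.factorial : ℚ)⁻¹) • act G Y (dp (Function.update z j a)) g 0 +
      ((n.factorial : ℚ)⁻¹) • act G Y (dp (Function.update z j b)) g 0 := by
    intro z j a b
    rw [← smul_add]
    congr 1
    have : dp (Function.update z j (a + b)) = dp (Function.update z j a) +
        dp (Function.update z j b) +
        dp (Fin.cons b (Function.update z j a) : Fin (n + 1) → G) := by
      rw [dp_succ, Fin.tail_cons, Fin.cons_zero]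
      simp only [dp_update, tr_add]
      ring
    rw [this, map_add, map_add, LinearMap.add_apply, LinearMap.add_apply, hg]
    simp
  let F : (Fin n → G) → Y := fun h => ((n.factorial : ℚ)⁻¹) • act G Y (dp h) g 0
  refine ⟨{ toFun := F, map_update_add' := ?_, map_update_smul' := ?_ }, fun h => rfl⟩
  · intro inst z j a b
    have : inst = instDecidableEqFin n := Subsingleton.elim _ _
    subst this
    exact hadd z j a b
  · intro inst z j c a
    have : inst = instDecidableEqFin n := Subsingleton.elim _ _
    subst this
    exact map_zsmul (AddMonoidHom.mk' (fun a => F (Function.update z j a)) (hadd z j)) c a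

lemma decomp (n : ℕ) : ∀ g : G → Y, (∀ h : Fin n → G, act G Y (dp h) g = 0) →
    ∃ A : (k : ℕ) → MultilinearMap ℤ (fun _ : Fin k => G) Y,
      (∀ k z (σ : Equiv.Perm (Fin k)), A k (z ∘ σ) = A k z) ∧
      ∀ z, g z = ∑ k ∈ range n, A k (fun _ => z) := by
  induction n with
  | zero =>
    intro g hg
    refine ⟨fun _ => 0, by simp, fun z => ?_⟩
    have := congrFun (hg (fun _ => 0)) z
    simpa [dp] using this
  | succ n ih =>
    intro g hg
    obtain ⟨B, hB⟩ := exists_top n g hg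
    have hBs : ∀ z (σ : Equiv.Perm (Fin n)), B (z ∘ σ) = B z := by
      intro z σ
      rw [hB, hB]
      have : dp (z ∘ σ) = dp z := Equiv.prod_comp σ (fun i => tr (z i) - 1)
      rw [this]
    have hconst : ∀ (h : Fin n → G) x, act G Y (dp h) g x = act G Y (dp h) g 0 := by
      intro h x
      have e := congrFun (hg (Fin.cons x h)) 0
      rw [dp_succ, mul_comm, act_mul, act_d, Fin.tail_cons, Fin.cons_zero, zero_add] at e
      exact sub_eq_zero.1 e
    obtain ⟨A, hA, hA'⟩ := ih (g - fun x => B (fun _ => x)) (by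
      intro h
      rw [map_sub, polar n B hBs h]
      funext x
      rw [Pi.sub_apply, hconst, hB, ← Nat.cast_smul_eq_nsmul ℚ, smul_smul,
        mul_inv_cancel₀ (by exact_mod_cast n.factorial_ne_zero), one_smul, sub_self]
      rfl)
    refine ⟨Function.update A n B, ?_, ?_⟩
    · intro k
      by_cases hk : k = n
      · subst hk; simpa using hBs
      · simpa [hk] using hA k
    · intro z
      rw [sum_range_succ, Function.update_self]
      have := hA' z
      rw [Pi.sub_apply, sub_eq_iff_eq_add] at this
      rw [this]
      congr 1
      refine sum_congr rfl fun k hk => ?_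
      rw [Function.update_of_ne (mem_range.1 hk).ne]

end decomp

lemma phi_bound (𝕂 : Type*) [NormedField 𝕂] (r : ℝ) (hr : 0 < r) (m : ℕ) :
    0 < phiRadius 𝕂 r m ∧ ∀ t : ℕ, 1 ≤ t → t ≤ m + 1 →
      ‖((t : 𝕂))⁻¹‖ * phiRadius 𝕂 r m ≤ r := by
  classical
  unfold phiRadius
  set F : {x // x ∈ Finset.Icc 2 (m + 1)} → ℝ := fun k => (Finset.Icc 1 k.1).sup'
        (Finset.nonempty_Icc.mpr (le_trans one_le_two (Finset.mem_Icc.mp k.2).1))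
        fun t => ‖((t : 𝕂))⁻¹‖ with hF
  have hle : ∀ (k : {x // x ∈ Finset.Icc 2 (m + 1)}) (t : ℕ), 1 ≤ t → t ≤ k.1 →
      ‖((t : 𝕂))⁻¹‖ ≤ F k := by
    intro k t h1 h2
    exact Finset.le_sup' (fun t : ℕ => ‖((t : 𝕂))⁻¹‖) (Finset.mem_Icc.2 ⟨h1, h2⟩)
  have hone : ∀ k, 1 ≤ F k := by
    intro k
    have := hle k 1 le_rfl (le_trans one_le_two (Finset.mem_Icc.mp k.2).1)
    simpa using this
  have hP : 1 ≤ (Finset.Icc 2 (m + 1)).attach.prod F := Finset.one_le_prod fun k _ => hone k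
  refine ⟨by positivity, fun t h1 h2 => ?_⟩
  have ht : ‖((t : 𝕂))⁻¹‖ ≤ (Finset.Icc 2 (m + 1)).attach.prod F := by
    rcases h1.eq_or_lt with rfl | h3
    · simpa using hP
    · have hk := Finset.mem_Icc.2 ⟨h3, h2⟩
      have h4 := hle ⟨t, hk⟩ t h1 le_rfl
      rw [← Finset.mul_prod_erase _ F (Finset.mem_attach _ ⟨t, hk⟩)]
      have h5 : 1 ≤ ∏ x ∈ (Finset.Icc 2 (m + 1)).attach.erase ⟨t, hk⟩, F x :=
        Finset.one_le_prod fun k _ => hone k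
      nlinarith [hone ⟨t, hk⟩]
  have hP0 : 0 < (Finset.Icc 2 (m + 1)).attach.prod F := by linarith
  rw [mul_comm, mul_assoc]
  refine mul_le_of_le_one_right hr.le ?_
  rw [inv_mul_le_iff₀ hP0, mul_one]
  exact ht

/-- The closed ball as a subgroup. -/
def ballSub (X : Type*) [NormedAddCommGroup X] [IsUltrametricDist X] (ρ : ℝ) (hρ : 0 ≤ ρ) :
    AddSubgroup X where
  carrier := {x | ‖x‖ ≤ ρ}
  zero_mem' := by simpa using hρ
  add_mem' {a b} ha hb := (IsUltrametricDist.norm_add_le_max a b).trans (max_le ha hb)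
  neg_mem' {a} ha := by simpa using ha

lemma act_restrict {X Y : Type*} [AddCommGroup X] [AddCommGroup Y] (G : AddSubgroup X) (x₀ : X)
    (n : ℕ) : ∀ (f : X → Y) (h : Fin n → G) (z : G),
    act G Y (dp h) (fun z : G => f (x₀ + z)) z =
      act X Y (dp fun i => (h i : X)) f (x₀ + z) := by
  induction n with
  | zero => intro f h z; simp [dp]
  | succ n ih =>
    intro f h z
    rw [dp_succ, act_mul, dp_succ, act_mul]
    have := ih (act X Y (tr (h 0 : X) - 1) f) (Fin.tail h) z
    refine Eq.trans ?_ this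
    have e : act G Y (tr (h 0) - 1) (fun z : G => f (x₀ + z)) =
        fun z : G => act X Y (tr (h 0 : X) - 1) f (x₀ + z) := by
      funext w
      rw [act_d, act_d]
      simp [add_assoc]
    rw [e]

end ULP

/-- Characterization of uniformly locally polynomial functions: if
`Δ_h^{m+1} f = 0` on `X` for all `h ∈ B_X(r)`, then around every point `x₀ ∈ X`
the function `f` is, on `x₀ + B_X(φ(r,m))`, a sum of a constant and the
diagonalizations of symmetric `k`-additive maps, `k = 1, …, m`. -/
theorem uniformly_locally_polynomial_characterization
    (𝕂 : Type*) [NormedField 𝕂] [CharZero 𝕂] [IsUltrametricDist 𝕂]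
    (X : Type*) [NormedAddCommGroup X] [NormedSpace 𝕂 X] [IsUltrametricDist X]
    (Y : Type*) [AddCommGroup Y] [Module ℚ Y]
    (m : ℕ) (r : ℝ) (hr : 0 < r) (f : X → Y)
    (hf : ∀ x h : X, ‖h‖ ≤ r → (fwdDiffOp h)^[m + 1] f x = 0) :
    ∀ x₀ : X, ∃ A₀ : Y, ∃ A : (k : ℕ) → (Fin k → X) → Y,
      (∀ k : ℕ, 1 ≤ k → k ≤ m → IsSymmAddOn (phiRadius 𝕂 r m) k (A k)) ∧
      ∀ z : X, ‖z‖ ≤ phiRadius 𝕂 r m →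
        f (x₀ + z) = A₀ + ∑ k ∈ Finset.Icc 1 m, A k (fun _ => z) := by
  classical
  intro x₀
  obtain ⟨hρ, hb⟩ := ULP.phi_bound 𝕂 r hr m
  set ρ := phiRadius 𝕂 r m with hρdef
  let G := ULP.ballSub X ρ hρ.le
  have hX : ∀ h : Fin (m + 1) → G, ULP.act X Y (ULP.dp fun i => (h i : X)) f = 0 := by
    intro h
    rw [ULP.djok 𝕂, map_sum, LinearMap.sum_apply]
    refine Finset.sum_eq_zero fun S _ => ?_
    rw [ULP.act_mul, ULP.act_mul, ← ULP.iter_eq]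
    have : (fwdDiffOp (∑ j ∈ S, -(((j : ℕ) + 1 : ℕ) : 𝕂)⁻¹ • (h j : X)))^[m + 1] f = 0 := by
      funext x
      refine hf x _ ?_
      refine IsUltrametricDist.norm_sum_le_of_forall_le_of_nonneg hr.le fun j _ => ?_
      rw [norm_smul, norm_neg]
      refine le_trans ?_ (hb ((j : ℕ) + 1) (by omega) (by omega))
      exact mul_le_mul_of_nonneg_left (h j).2 (norm_nonneg _)
    rw [this, map_zero, map_zero]
  obtain ⟨A, hA, hA'⟩ := ULP.decomp (m + 1) (fun z : G => f (x₀ + z)) (by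
    intro h
    funext z
    rw [ULP.act_restrict, hX]
    rfl)
  obtain ⟨B, hB⟩ : ∃ B : (k : ℕ) → (Fin k → X) → Y, ∀ (k : ℕ) (z : Fin k → X)
      (hz : ∀ i, ‖z i‖ ≤ ρ), B k z = A k (fun i => (⟨z i, hz i⟩ : G)) :=
    ⟨fun k z => if hz : ∀ i, ‖z i‖ ≤ ρ then A k (fun i => (⟨z i, hz i⟩ : G)) else 0,
      fun k z hz => dif_pos hz⟩
  refine ⟨A 0 (fun _ => 0), B, ?_, ?_⟩
  · intro k _ _
    refine ⟨fun z hz σ => ?_, fun j z hz x y hx hy => ?_⟩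
    · have hz' : ∀ i, ‖(z ∘ σ) i‖ ≤ ρ := fun i => hz (σ i)
      rw [hB k z hz, hB k _ hz']
      exact hA k (fun i => (⟨z i, hz i⟩ : G)) σ
    · have hu : ∀ (w : X) (hw : ‖w‖ ≤ ρ), B k (Function.update z j w) =
          A k (Function.update (fun i => (⟨z i, hz i⟩ : G)) j ⟨w, hw⟩) := by
        intro w hw
        have hz' : ∀ i, ‖Function.update z j w i‖ ≤ ρ := by
          intro i
          by_cases hi : i = j
          · subst hi; simpa using hw
          · simpa [hi] using hz i
        rw [hB k _ hz']
        congr 1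
        funext i
        by_cases hi : i = j
        · subst hi; simp
        · simp [hi]
      have hxy : ‖x + y‖ ≤ ρ := (IsUltrametricDist.norm_add_le_max x y).trans (max_le hx hy)
      rw [hu x hx, hu y hy, hu _ hxy]
      exact (A k).map_update_add (fun i => (⟨z i, hz i⟩ : G)) j (⟨x, hx⟩ : G) (⟨y, hy⟩ : G)
  · intro z hz
    have e := hA' (⟨z, hz⟩ : G)
    rw [Finset.range_eq_Ico, Finset.sum_eq_sum_Ico_succ_bot (Nat.succ_pos m)] at e
    refine e.trans ?_
    congr 1
    · congr 1
      exact Subsingleton.elim _ _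
    · refine Finset.sum_congr (by ext; simp) fun k _ => ?_
      rw [hB k _ (fun _ => hz)]
end
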